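/- arXiv:0909.0340 — 2 statements merged into one kernel-verified Lean document; each statement's English description precedes it below -/
import Mathlib

section
/- Let E₈ ⊂ ℝ⁸ be the E₈ lattice and take n = 8 in the definition of p_m. Then for every m ∈ {1, 2, 3, 5} and every integer k ≥ 0: Σ_{(v,w)∈E₈×E₈, v≠0, w≠0, ‖v‖²+‖w‖²=k} p_m(⟨v,w⟩/(‖v‖‖w‖)) · ‖v‖^{2m}‖w‖^{2m} = 0. (Equivalently, the modular form Θ_{m,m,E₈} vanishes identically for these m.) -/
noncomputable section

open MvPolynomial MeasureTheory Finset
open scoped RealInnerProductSpace Manifold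

namespace Heat

abbrev Poly (n : ℕ) := MvPolynomial (Fin n) ℝ
abbrev E (n : ℕ) := EuclideanSpace ℝ (Fin n)

variable (n : ℕ)

/-- The differential operator `∂^I` on polynomials. -/
def pdI (I : Fin n →₀ ℕ) : Poly n → Poly n :=
  (List.ofFn fun i : Fin n => (fun p : Poly n => (⇑(pderiv i))^[I i] p)).foldr (· ∘ ·) id

/-- The differential pairing `⟨g, f⟩ = (g(∂)f)(0)`. -/
def dPair (g f : Poly n) : ℝ :=
  eval 0 (∑ I ∈ g.support, g.coeff I • pdI n I f)

/-- The Laplacian `Δ = -∑ ∂ᵢ²` as a linear map on polynomials. -/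
def lap : Poly n →ₗ[ℝ] Poly n :=
  -∑ i : Fin n, ((pderiv i : Derivation ℝ (Poly n) (Poly n)).toLinearMap ∘ₗ
    (pderiv i : Derivation ℝ (Poly n) (Poly n)).toLinearMap)

/-- `r² = ∑ xᵢ²`. -/
def rsq : Poly n := ∑ i : Fin n, X i ^ 2

/-- Harmonic homogeneous polynomials of degree `m`. -/
def Harm (m : ℕ) : Submodule ℝ (Poly n) :=
  homogeneousSubmodule (Fin n) ℝ m ⊓ LinearMap.ker (lap n)

/-- `B` is an orthonormal basis of the subspace `S` w.r.t. the differential pairing. -/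
structure IsONBasis (S : Submodule ℝ (Poly n)) (B : Finset (Poly n)) : Prop where
  mem : ∀ h ∈ B, h ∈ S
  ortho : ∀ h ∈ B, ∀ g ∈ B, dPair n h g = if h = g then 1 else 0
  span : Submodule.span ℝ (B : Set (Poly n)) = S

/-- Evaluation of a polynomial at a point of Euclidean space. -/
def peval (f : Poly n) (x : E n) : ℝ := eval (fun i => x i) f

/-- `μ` is the rotation-invariant probability measure on the unit sphere `S^{n-1}`. -/
structure IsSphereMeasure (μ : Measure (E n)) : Prop where
  prob : IsProbabilityMeasure μ
  supp : μ (Metric.sphere (0 : E n) 1)ᶜ = 0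
  inv : ∀ φ : E n ≃ₗᵢ[ℝ] E n, Measure.map φ μ = μ

/-- The lattice spanned (over `ℤ`) by the vectors `b`. -/
def latticeOf (b : Fin n → E n) : Submodule ℤ (E n) := Submodule.span ℤ (Set.range b)

/-- An integral lattice: all square norms are integers. -/
def IsIntegral (L : Submodule ℤ (E n)) : Prop := ∀ v ∈ L, ∃ z : ℤ, ‖v‖ ^ 2 = (z : ℝ)

/-- The matrix `A` with `½A` the Gram matrix of the basis `b`. -/
def evenGram (b : Fin n → E n) : Matrix (Fin n) (Fin n) ℝ :=
  Matrix.of fun i j => 2 * ⟪b i, b j⟫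

/-- A real matrix has integer entries and even diagonal. -/
def IntEvenDiag (M : Matrix (Fin n) (Fin n) ℝ) : Prop :=
  (∀ i j, ∃ z : ℤ, M i j = (z : ℝ)) ∧ ∀ i, ∃ z : ℤ, M i i = 2 * (z : ℝ)

/-- `N` is the level of the lattice with basis `b`. -/
def IsLevel (b : Fin n → E n) (N : ℕ) : Prop :=
  0 < N ∧ IntEvenDiag n ((N : ℝ) • (evenGram n b)⁻¹) ∧
    ∀ M : ℕ, 0 < M → IntEvenDiag n ((M : ℝ) • (evenGram n b)⁻¹) → N ≤ M

/-- The spherical theta function `Θ_{h,Λ}`. -/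
def theta (h : Poly n) (L : Submodule ℤ (E n)) (τ : UpperHalfPlane) : ℂ :=
  ∑' v : L, (peval n h (v : E n) : ℂ) *
    Complex.exp (2 * (Real.pi : ℂ) * Complex.I * ((‖(v : E n)‖ ^ 2 : ℝ) : ℂ) * (τ : ℂ))

/-- The image of the lattice `L` under an isometry of Euclidean space. -/
def mapLat (φ : E n ≃ₗᵢ[ℝ] E n) (L : Submodule ℤ (E n)) : Submodule ℤ (E n) :=
  L.map (φ.toLinearEquiv.toLinearMap.restrictScalars ℤ)

/-- The Kronecker symbol at 2, `(a/2)`. -/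
def kronAtTwo (a : ℤ) : ℤ :=
  if a % 2 = 0 then 0 else if a % 8 = 1 ∨ a % 8 = 7 then 1 else -1

/-- The Kronecker symbol `(a/m)`. -/
def kronSym (a m : ℤ) : ℤ :=
  if m = 0 then (if a = 1 ∨ a = -1 then 1 else 0)
  else
    (if m < 0 ∧ a < 0 then -1 else 1) *
      kronAtTwo a ^ (m.natAbs.factorization 2) *
      jacobiSym a (m.natAbs / 2 ^ (m.natAbs.factorization 2))

open UpperHalfPlane in
/-- `f` is a modular form of weight `w`, level `N` and character `χ`:  it is holomorphic
on the upper half plane, transforms under `Γ₀(N)` with automorphy factor `χ(d)(cτ+d)^w`,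
and is bounded towards all cusps. -/
structure IsModularForm (N : ℕ) (w : ℝ) (χ : ℤ → ℤ) (f : UpperHalfPlane → ℂ) : Prop where
  holo : MDifferentiable 𝓘(ℂ) 𝓘(ℂ) f
  transf : ∀ γ : Matrix.SpecialLinearGroup (Fin 2) ℤ, γ ∈ CongruenceSubgroup.Gamma0 N →
    ∀ τ : UpperHalfPlane, f (γ • τ) =
      ((χ ((γ : Matrix (Fin 2) (Fin 2) ℤ) 1 1) : ℝ) : ℂ) *
      (((((γ : Matrix (Fin 2) (Fin 2) ℤ) 1 0 : ℤ) : ℂ)) * (τ : ℂ) +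
        (((γ : Matrix (Fin 2) (Fin 2) ℤ) 1 1 : ℤ) : ℂ)) ^ (w : ℂ) * f τ
  bdd : ∀ γ : Matrix.SpecialLinearGroup (Fin 2) ℤ,
    IsBoundedAtImInfty fun τ : UpperHalfPlane =>
      (((((γ : Matrix (Fin 2) (Fin 2) ℤ) 1 0 : ℤ) : ℂ)) * (τ : ℂ) +
        (((γ : Matrix (Fin 2) (Fin 2) ℤ) 1 1 : ℤ) : ℂ)) ^ (-(w : ℂ)) * f (γ • τ)

/-- The trivial character. -/
def trivChar : ℤ → ℤ := fun _ => 1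

open scoped Classical in
/-- The multiple theta series `Θ_{m₁,…,m_k,Λ}` attached to a family of bases `B i`. -/
def thetaMulti (k : ℕ) (B : Fin k → Finset (Poly n)) (L : Submodule ℤ (E n))
    (μ : Measure (E n)) (τ : UpperHalfPlane) : ℂ :=
  ∑ g ∈ Fintype.piFinset B,
    (∏ i, theta n (g i) L τ) * (((∫ x, ∏ i, peval n (g i) x ∂μ) : ℝ) : ℂ)

/-- The polynomial `p_m` (evaluated at `c`). -/
def pmVal (m : ℕ) (c : ℝ) : ℝ :=
  ∑ k ∈ Finset.range (m + 1),
    (-1 : ℝ) ^ k * c ^ (2 * m - 2 * k) /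
      ((Nat.factorial (2 * m - 2 * k) : ℝ) * (Nat.factorial k : ℝ) * 2 ^ k *
        ∏ l ∈ Finset.range k, ((n : ℝ) + 4 * m - 4 - 2 * l))

/-- The heat flux `f_Λ` of the lattice `L`. -/
def heatF (L : Submodule ℤ (E n)) (t : ℝ) (x : E n) : ℝ :=
  (4 * Real.pi * t) ^ (-(n : ℝ) / 2) * ∑' γ : L, Real.exp (-‖x - (γ : E n)‖ ^ 2 / (4 * t))

/-- Partial derivative of a function on Euclidean space. -/
def pdFun (i : Fin n) (F : E n → ℝ) : E n → ℝ := fun x => fderiv ℝ F x (EuclideanSpace.single i 1)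

/-- Iterated partial derivative `∂^I` of a function on Euclidean space. -/
def pdIFun (I : Fin n →₀ ℕ) : (E n → ℝ) → (E n → ℝ) :=
  (List.ofFn fun i : Fin n => (fun F : E n → ℝ => (pdFun n i)^[I i] F)).foldr (· ∘ ·) id

/-- The differential operator `g(∂)` applied to a smooth function. -/
def applyDiff (g : Poly n) (F : E n → ℝ) (x : E n) : ℝ :=
  ∑ I ∈ g.support, g.coeff I * pdIFun n I F x

open scoped Classical in
/-- The degree `2m` homogeneous term of the Taylor expansion of `x ↦ f_Λ(t,x)` at `0`. -/
def taylorTerm (L : Submodule ℤ (E n)) (m : ℕ) (t : ℝ) : Poly n :=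
  ∑ c ∈ (Fintype.piFinset fun _ : Fin n => Finset.range (2 * m + 1)).filter
      (fun c => ∑ i, c i = 2 * m),
    (pdIFun n (Finsupp.equivFunOnFinite.symm c) (heatF n L t) 0 /
      ∏ i, (Nat.factorial (c i) : ℝ)) • ∏ i, X i ^ c i

/-- `P` is the orthogonal projection of `A_m` onto `Harm_m` w.r.t. the differential
pairing: on `A_m` it takes values in `Harm_m`, `f - P f` is orthogonal to `Harm_m`,
and it is the identity on `Harm_m`. -/
def IsHarmProj (m : ℕ) (P : Poly n → Poly n) : Prop :=
  (∀ f ∈ homogeneousSubmodule (Fin n) ℝ m, P f ∈ Harm n m ∧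
    ∀ h ∈ Harm n m, dPair n h (f - P f) = 0) ∧
  ∀ h ∈ Harm n m, P h = h

/-- The `E₈` lattice as a subset of `ℝ⁸`. -/
def E8set : Set (E 8) :=
  {x | ((∀ i, ∃ z : ℤ, x i = (z : ℝ)) ∨ (∀ i, ∃ z : ℤ, x i = (z : ℝ) + 1 / 2)) ∧
    ∃ z : ℤ, (∑ i, x i) = 2 * (z : ℝ)}

end Heat

namespace Heat

variable (n : ℕ)

/-- The operator `P_{harm,m} = ∑_{k=0}^{⌊m/2⌋} r_{k,m} · r^{2k} Δ^k` on polynomials. -/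
def PharmOp (m : ℕ) : Poly n → Poly n := fun f =>
  ∑ k ∈ Finset.range (m / 2 + 1),
    (1 / ((2 : ℝ) ^ k * (Nat.factorial k : ℝ) *
      ∏ l ∈ Finset.range k, ((n : ℝ) + 2 * (m : ℝ) - 4 - 2 * (l : ℝ)))) •
      (rsq n ^ k * ((lap n ^ k) f))

/-- The quantity `Ξ(u,v,w)`. -/
def Xi (u v w : E n) : ℝ :=
  2 * ‖u‖ ^ 2 * ‖v‖ ^ 2 * ‖w‖ ^ 2 -
    (n : ℝ) * (‖u‖ ^ 2 * ⟪v, w⟫ ^ 2 + ‖v‖ ^ 2 * ⟪u, w⟫ ^ 2 + ‖w‖ ^ 2 * ⟪u, v⟫ ^ 2) +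
    (n : ℝ) ^ 2 * ⟪v, w⟫ * ⟪u, w⟫ * ⟪u, v⟫

/-- The `k`-th coefficient of the claimed q-expansion of `Θ_{m,m,Λ}`. -/
def mmCoeff (m : ℕ) (L : Submodule ℤ (E n)) (k : ℕ) : ℝ :=
  ∑' p : {p : L × L // (p.1 : E n) ≠ 0 ∧ (p.2 : E n) ≠ 0 ∧
      ‖(p.1 : E n)‖ ^ 2 + ‖(p.2 : E n)‖ ^ 2 = (k : ℝ)},
    pmVal n m (⟪(p.1.1 : E n), (p.1.2 : E n)⟫ / (‖(p.1.1 : E n)‖ * ‖(p.1.2 : E n)‖)) *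
      ‖(p.1.1 : E n)‖ ^ (2 * m) * ‖(p.1.2 : E n)‖ ^ (2 * m)

/-- The sum `∑ Ξ(u,v,w)` over lattice triples of total square norm `k`. -/
def tripleCoeff (L : Submodule ℤ (E n)) (k : ℕ) : ℝ :=
  ∑' t : {t : L × L × L //
      ‖(t.1 : E n)‖ ^ 2 + ‖(t.2.1 : E n)‖ ^ 2 + ‖(t.2.2 : E n)‖ ^ 2 = (k : ℝ)},
    Xi n (t.1.1 : E n) (t.1.2.1 : E n) (t.1.2.2 : E n)

/-- The generalized binomial coefficient `C(z,k) = z(z-1)⋯(z-k+1)/k!`. -/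
def genBinom (z : ℝ) (k : ℕ) : ℝ :=
  (∏ a ∈ Finset.range k, (z - (a : ℝ))) / (Nat.factorial k : ℝ)

open scoped Classical in
/-- The monomial orthonormal basis `{xᵢ²/√2} ∪ {xᵢxⱼ, i<j}` of `A₂`. -/
def B2 : Finset (Poly n) :=
  (Finset.univ.image fun i : Fin n => (Real.sqrt 2)⁻¹ • (X i ^ 2 : Poly n)) ∪
  ((Finset.univ.filter fun p : Fin n × Fin n => p.1 < p.2).image
    fun p => (X p.1 * X p.2 : Poly n))

/-- The explicit harmonic projection in degree two, `P = id + (1/(2n)) r² Δ`. -/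
def P2 : Poly n → Poly n := fun g => g + (1 / (2 * (n : ℝ))) • (rsq n * lap n g)

end Heat
namespace Heat


/-- Sorted exponent vectors: `rep m s` is the increasing vector with sum `m`, square sum `s`. -/
def rep : ℕ → ℕ → Fin 8 → ℕ
  | 1, _ => ![0,0,0,0,0,0,0,1]
  | 2, 4 => ![0,0,0,0,0,0,0,2]
  | 2, _ => ![0,0,0,0,0,0,1,1]
  | 3, 9 => ![0,0,0,0,0,0,0,3]
  | 3, 5 => ![0,0,0,0,0,0,1,2]
  | 3, _ => ![0,0,0,0,0,1,1,1]
  | 5, 25 => ![0,0,0,0,0,0,0,5]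
  | 5, 17 => ![0,0,0,0,0,0,1,4]
  | 5, 13 => ![0,0,0,0,0,0,2,3]
  | 5, 11 => ![0,0,0,0,0,1,1,3]
  | 5, 9 => ![0,0,0,0,0,1,2,2]
  | 5, 7 => ![0,0,0,0,1,1,1,2]
  | 5, _ => ![0,0,0,1,1,1,1,1]
  | _, _ => 0

/-- the possible square sums -/
def sqs : ℕ → Finset ℕ
  | 1 => {1}
  | 2 => {4, 2}
  | 3 => {9, 5, 3}
  | 5 => {25, 17, 13, 11, 9, 7, 5}
  | _ => ∅

lemma rep_spec : ∀ m ∈ [1,2,3,5], ∀ b ∈ List.Nat.antidiagonalTuple 8 m,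
    (∀ i : Fin 7, b i.castSucc ≤ b i.succ) →
      b = rep m (∑ i, b i ^ 2) ∧ ∑ i, b i ^ 2 ∈ sqs m := by
  decide +kernel

lemma sqs_spec4 : ∀ m ∈ [1,2,3,5], ∀ b ∈ List.Nat.antidiagonalTuple 4 m,
    ∑ i, b i ^ 2 ∈ sqs m := by
  decide +kernel

/-- weighted count of exponent vectors -/
def cnt (m s : ℕ) (x : Fin 4 → ℤ) : ℤ :=
  (((List.Nat.antidiagonalTuple 4 m).filter (fun b => ∑ i, b i ^ 2 = s)).map
    (fun b => ∏ i, x i ^ (2 * b i))).sum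


lemma cnt_vals2 : cnt 2 4 ![2,0,0,0] = 16 ∧ cnt 2 2 ![2,0,0,0] = 0 ∧
    cnt 2 4 ![1,-1,-1,-1] = 4 ∧ cnt 2 2 ![1,-1,-1,-1] = 6 := by
  decide +kernel

lemma cnt_vals3 : cnt 3 9 ![2,0,0,0] = 64 ∧ cnt 3 5 ![2,0,0,0] = 0 ∧
    cnt 3 3 ![2,0,0,0] = 0 ∧
    cnt 3 9 ![1,-1,-1,-1] = 4 ∧ cnt 3 5 ![1,-1,-1,-1] = 12 ∧
    cnt 3 3 ![1,-1,-1,-1] = 4 := by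
  decide +kernel

lemma cnt_vals5 : (cnt 5 25 ![2,0,0,0] = 1024 ∧ cnt 5 17 ![2,0,0,0] = 0 ∧
    cnt 5 13 ![2,0,0,0] = 0 ∧ cnt 5 11 ![2,0,0,0] = 0 ∧
    cnt 5 9 ![2,0,0,0] = 0 ∧ cnt 5 7 ![2,0,0,0] = 0 ∧
    cnt 5 5 ![2,0,0,0] = 0) ∧
    (cnt 5 25 ![1,-1,-1,-1] = 4 ∧ cnt 5 17 ![1,-1,-1,-1] = 12 ∧
    cnt 5 13 ![1,-1,-1,-1] = 12 ∧ cnt 5 11 ![1,-1,-1,-1] = 12 ∧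
    cnt 5 9 ![1,-1,-1,-1] = 12 ∧ cnt 5 7 ![1,-1,-1,-1] = 4 ∧
    cnt 5 5 ![1,-1,-1,-1] = 0) ∧
    (cnt 5 25 ![3,1,0,0] = 59050 ∧ cnt 5 17 ![3,1,0,0] = 6570 ∧
    cnt 5 13 ![3,1,0,0] = 810 ∧ cnt 5 11 ![3,1,0,0] = 0 ∧
    cnt 5 9 ![3,1,0,0] = 0 ∧ cnt 5 7 ![3,1,0,0] = 0 ∧
    cnt 5 5 ![3,1,0,0] = 0) ∧
    (cnt 5 25 ![1,-1,-2,-2] = 2050 ∧ cnt 5 17 ![1,-1,-2,-2] = 3090 ∧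
    cnt 5 13 ![1,-1,-2,-2] = 2370 ∧ cnt 5 11 ![1,-1,-2,-2] = 1200 ∧
    cnt 5 9 ![1,-1,-2,-2] = 840 ∧ cnt 5 7 ![1,-1,-2,-2] = 160 ∧
    cnt 5 5 ![1,-1,-2,-2] = 0) := by
  decide +kernel


/-- exponent vector as a finitely supported function -/
def ex (b : Fin 8 → ℕ) : Fin 8 →₀ ℕ := Finsupp.equivFunOnFinite.symm b

@[simp] lemma ex_apply (b : Fin 8 → ℕ) (i : Fin 8) : ex b i = b i := rfl

/-- block reflection -/
def blk (w : Fin 8 → ℝ) : Fin 8 → ℝ := fun i =>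
  w i - (if i.val < 4 then w 0 + w 1 + w 2 + w 3 else w 4 + w 5 + w 6 + w 7) / 2

/-- flip two signs -/
def flip2 (i j : Fin 8) (w : Fin 8 → ℝ) : Fin 8 → ℝ := fun k =>
  (if k = i ∨ k = j then -1 else 1) * w k

lemma coeff_perm (F : MvPolynomial (Fin 8) ℝ)
    (h : ∀ σ : Equiv.Perm (Fin 8), ∀ w : Fin 8 → ℝ, eval (w ∘ σ) F = eval w F)
    (σ : Equiv.Perm (Fin 8)) (b : Fin 8 → ℕ) :
    coeff (ex (b ∘ σ)) F = coeff (ex b) F := by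
  have h1 : rename σ F = F := by
    apply MvPolynomial.funext
    intro w
    rw [eval_rename, h]
  have h2 := coeff_rename_mapDomain σ σ.injective F (ex (b ∘ σ))
  rw [h1] at h2
  rw [← h2]
  congr 1
  ext i
  rw [Finsupp.mapDomain_equiv_apply]
  simp

lemma coeff_scale (ε : Fin 8 → ℝ) (F : MvPolynomial (Fin 8) ℝ) (d : Fin 8 →₀ ℕ) :
    coeff d (aeval (fun i => C (ε i) * X i : Fin 8 → MvPolynomial (Fin 8) ℝ) F)
      = (∏ i, ε i ^ d i) * coeff d F := by
  induction F using MvPolynomial.induction_on' with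
  | add p q hp hq => rw [map_add, coeff_add, coeff_add, hp, hq, mul_add]
  | monomial n a =>
    have : aeval (fun i => C (ε i) * X i : Fin 8 → MvPolynomial (Fin 8) ℝ) (monomial n a)
        = monomial n ((∏ i, ε i ^ n i) * a) := by
      rw [aeval_monomial, Finsupp.prod_fintype _ _ (by simp)]
      simp only [mul_pow, Finset.prod_mul_distrib]
      rw [monomial_eq, Finsupp.prod_fintype _ _ (by simp)]
      simp only [MvPolynomial.algebraMap_eq, map_mul, map_prod, map_pow]
      ring
    rw [this, coeff_monomial, coeff_monomial]
    by_cases hn : n = d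
    · simp [hn]
    · simp [hn]

lemma parity (F : MvPolynomial (Fin 8) ℝ)
    (h : ∀ i j : Fin 8, i ≠ j → ∀ w : Fin 8 → ℝ, eval (flip2 i j w) F = eval w F)
    (d : Fin 8 →₀ ℕ) (hd : coeff d F ≠ 0) (i j : Fin 8) : d i % 2 = d j % 2 := by
  by_cases hij : i = j
  · rw [hij]
  have h1 : aeval (fun k => C (if k = i ∨ k = j then -1 else 1) * X k :
      Fin 8 → MvPolynomial (Fin 8) ℝ) F = F := by
    apply MvPolynomial.funext
    intro w
    rw [← h i j hij w]
    change eval₂Hom _ _ (bind₁ _ F) = eval₂Hom _ _ F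
    rw [eval₂Hom_bind₁]
    congr 2
    funext k
    simp only [coe_eval₂Hom, eval₂_mul, eval₂_C, eval₂_X, RingHom.id_apply, flip2]
  have h2 := coeff_scale (fun k => if k = i ∨ k = j then -1 else 1) F d
  rw [h1] at h2
  have h3 : ∏ k, (if k = i ∨ k = j then (-1 : ℝ) else 1) ^ d k = (-1) ^ (d i + d j) := by
    rw [← Finset.prod_subset (Finset.subset_univ {i, j})]
    · rw [Finset.prod_pair hij]; simp [pow_add]
    · intro k _ hk
      simp at hk
      simp [hk]
  rw [h3] at h2
  rcases Nat.even_or_odd (d i + d j) with he | ho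
  · have := Nat.even_iff.mp he; omega
  · rw [ho.neg_one_pow] at h2
    exact absurd (by linarith) hd

lemma lap_coeff (F : MvPolynomial (Fin 8) ℝ) (h : ∑ i, pderiv i (pderiv i F) = 0)
    (d : Fin 8 → ℕ) : ∑ i, ((d i : ℝ) + 2) * (d i + 1) *
      coeff (ex (fun k => d k + if k = i then 2 else 0)) F = 0 := by
  have h1 := congrArg (coeff (ex d)) h
  rw [coeff_sum, coeff_zero] at h1
  rw [← h1]
  apply Finset.sum_congr rfl
  intro i _
  rw [coeff_pderiv, coeff_pderiv]
  have : ex (fun k => d k + if k = i then 2 else 0)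
      = ex d + Finsupp.single i 1 + Finsupp.single i 1 := by
    ext k
    by_cases hk : k = i
    · subst hk; simp
    · simp [hk]
  rw [this]
  simp
  ring

lemma sorted_coeff (F : MvPolynomial (Fin 8) ℝ) (m : ℕ) (hm : m ∈ [1,2,3,5])
    (h : ∀ σ : Equiv.Perm (Fin 8), ∀ w : Fin 8 → ℝ, eval (w ∘ σ) F = eval w F)
    (b : Fin 8 → ℕ) (hb : ∑ i, b i = m) :
    coeff (ex (fun i => 2 * b i)) F = coeff (ex (fun i => 2 * rep m (∑ i, b i ^ 2) i)) F
      ∧ ∑ i, b i ^ 2 ∈ sqs m := by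
  set σ := Tuple.sort b
  have hmono := Tuple.monotone_sort b
  have hs : ∑ i, (b ∘ σ) i = m := by
    rw [← hb]; exact Equiv.sum_comp σ b
  have hs2 : ∑ i, (b ∘ σ) i ^ 2 = ∑ i, b i ^ 2 := Equiv.sum_comp σ (fun i => b i ^ 2)
  have := rep_spec m hm (b ∘ σ) (List.Nat.mem_antidiagonalTuple.mpr hs)
    (fun i => hmono (Fin.castSucc_lt_succ).le)
  rw [hs2] at this
  refine ⟨?_, this.2⟩
  rw [← this.1]
  exact (coeff_perm F h σ (fun i => 2 * b i)).symm

lemma poly_zero_aux (F : MvPolynomial (Fin 8) ℝ) (m : ℕ) (hm : m ∈ [1,2,3,5])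
    (hF : F.IsHomogeneous (2 * m))
    (hl : ∑ i, pderiv i (pderiv i F) = 0)
    (hp : ∀ σ : Equiv.Perm (Fin 8), ∀ w : Fin 8 → ℝ, eval (w ∘ σ) F = eval w F)
    (hs : ∀ i j : Fin 8, i ≠ j → ∀ w : Fin 8 → ℝ, eval (flip2 i j w) F = eval w F)
    (d : Fin 8 →₀ ℕ) (hd : coeff d F ≠ 0) :
    ∃ b : Fin 8 → ℕ, ∑ i, b i = m ∧ d = ex (fun i => 2 * b i) := by
  have hdeg : ∑ i, d i = 2 * m := by
    have := hF hd
    rw [Finsupp.weight_apply, Finsupp.sum_fintype _ _ (by simp)] at this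
    simpa using this
  have hpar := parity F hs d hd
  by_cases h0 : d 0 % 2 = 0
  · refine ⟨fun i => d i / 2, ?_, ?_⟩
    · have : ∑ i, 2 * (d i / 2) = 2 * m := by
        rw [← hdeg]
        apply Finset.sum_congr rfl
        intro i _
        have := hpar i 0
        omega
      rw [← Finset.mul_sum] at this
      show ∑ i, d i / 2 = m
      omega
    · ext i
      have := hpar i 0
      simp
      omega
  · exfalso
    have hodd : ∀ i, d i = 2 * (d i / 2) + 1 := fun i => by
      have := hpar i 0
      omega
    have hsum : ∑ i, (d i / 2) + 4 = m := by
      have : ∑ i, (2 * (d i / 2) + 1) = 2 * m := by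
        rw [← hdeg]
        exact Finset.sum_congr rfl (fun i _ => (hodd i).symm)
      rw [Finset.sum_add_distrib, ← Finset.mul_sum] at this
      simp at this
      omega
    have hm5 : ∑ i, (d i / 2) = 1 := by
      simp at hm
      omega
    obtain ⟨i, hi⟩ : ∃ i, d i / 2 ≠ 0 := by
      by_contra hcon
      push Not at hcon
      simp [hcon] at hm5
    have hdi : d = ex (fun k => 1 + if k = i then 2 else 0) := by
      have hrest : ∀ k, k ≠ i → d k / 2 = 0 := by
        intro k hk
        have := Finset.sum_le_sum_of_subset (f := fun i => d i / 2) (Finset.subset_univ {i, k})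
        rw [Finset.sum_pair hk.symm] at this
        omega
      have hi1 : d i / 2 ≤ 1 := by
        rw [← hm5]
        exact Finset.single_le_sum (f := fun i => d i / 2) (by simp) (Finset.mem_univ i)
      ext k
      have := hodd k
      by_cases hk : k = i
      · subst hk
        simp
        omega
      · have := hrest k hk
        simp [hk]
        omega
    have h3 := lap_coeff F hl (fun _ => 1)
    have h4 : ∀ j, coeff (ex (fun k => 1 + if k = j then 2 else 0)) F = coeff d F := by
      intro j
      rw [hdi, ← coeff_perm F hp (Equiv.swap i j)]
      congr 2
      funext k
      simp [Equiv.swap_apply_eq_iff]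
    simp only [h4] at h3
    rw [Finset.sum_const] at h3
    norm_num at h3
    exact hd h3

lemma eval_four (F : MvPolynomial (Fin 8) ℝ) (m : ℕ) (A : ℕ → ℝ)
    (hsup : ∀ d, coeff d F ≠ 0 → ∃ b : Fin 8 → ℕ, ∑ i, b i = m ∧ d = ex (fun i => 2 * b i))
    (hA : ∀ b : Fin 8 → ℕ, ∑ i, b i = m → coeff (ex (fun i => 2 * b i)) F = A (∑ i, b i ^ 2))
    (hm : m ∈ [1,2,3,5]) (x : Fin 4 → ℤ) :
    eval (![(x 0 : ℝ), x 1, x 2, x 3, 0, 0, 0, 0]) F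
      = ∑ s ∈ sqs m, A s * cnt m s x := by
  classical
  let y : Fin 8 → ℝ := ![(x 0 : ℝ), x 1, x 2, x 3, 0, 0, 0, 0]
  let ap : (Fin 4 → ℕ) → (Fin 8 → ℕ) := fun b => ![b 0, b 1, b 2, b 3, 0, 0, 0, 0]
  let g : (Fin 4 → ℕ) → (Fin 8 →₀ ℕ) := fun b => ex (fun i => 2 * ap b i)
  have hg : Function.Injective g := by
    intro b c hbc
    have h0 := DFunLike.congr_fun hbc 0
    have h1 := DFunLike.congr_fun hbc 1
    have h2 := DFunLike.congr_fun hbc 2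
    have h3 := DFunLike.congr_fun hbc 3
    simp [g, ap] at h0 h1 h2 h3
    funext i
    fin_cases i <;> simp [h0, h1, h2, h3]
  have h1 : eval y F = ∑ d ∈ (Finset.Nat.antidiagonalTuple 4 m).image g,
      coeff d F * ∏ i, y i ^ d i := by
    rw [eval_eq']
    have e1 := Finset.sum_subset (s₁ := F.support)
      (s₂ := F.support ∪ (Finset.Nat.antidiagonalTuple 4 m).image g)
      (f := fun d => coeff d F * ∏ i, y i ^ d i) Finset.subset_union_left (by
        intro d _ hd
        simp only [notMem_support_iff] at hd
        simp [hd])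
    have e2 := Finset.sum_subset (s₁ := (Finset.Nat.antidiagonalTuple 4 m).image g)
      (s₂ := F.support ∪ (Finset.Nat.antidiagonalTuple 4 m).image g)
      (f := fun d => coeff d F * ∏ i, y i ^ d i) Finset.subset_union_right (by
        intro d _ hd
        by_cases hc : coeff d F = 0
        · simp [hc]
        obtain ⟨b, hb, rfl⟩ := hsup d hc
        have : ∃ j : Fin 8, y j = 0 ∧ b j ≠ 0 := by
          by_contra hcon
          push Not at hcon
          have h4 := hcon 4 (by simp [y])
          have h5 := hcon 5 (by simp [y])
          have h6 := hcon 6 (by simp [y])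
          have h7 := hcon 7 (by simp [y])
          apply hd
          have hb' : b = ap ![b 0, b 1, b 2, b 3] := by
            funext i
            fin_cases i <;> simp [ap, h4, h5, h6, h7]
          rw [Finset.mem_image]
          refine ⟨![b 0, b 1, b 2, b 3], ?_, ?_⟩
          · rw [Finset.Nat.mem_antidiagonalTuple, ← hb]
            simp [Fin.sum_univ_eight, Fin.sum_univ_four, h4, h5, h6, h7]
          · simp only [g]
            rw [← hb']
        obtain ⟨j, hj, hbj⟩ := this
        have : ∏ i, y i ^ (ex (fun i => 2 * b i)) i = 0 := by
          apply Finset.prod_eq_zero (Finset.mem_univ j)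
          simp [hj, hbj]
        simp only [this, mul_zero])
    rw [e1, ← e2]
  change eval y F = _
  rw [h1, Finset.sum_image hg.injOn]
  have h2 : ∀ b ∈ Finset.Nat.antidiagonalTuple 4 m,
      coeff (g b) F * ∏ i, y i ^ (g b) i = A (∑ i, b i ^ 2) * ((∏ i, x i ^ (2 * b i) : ℤ) : ℝ) := by
    intro b hb
    rw [Finset.Nat.mem_antidiagonalTuple] at hb
    have e : ∑ i, ap b i = m := by
      simp [ap, ← hb, Fin.sum_univ_eight, Fin.sum_univ_four]
    have e2 : ∑ i, ap b i ^ 2 = ∑ i, b i ^ 2 := by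
      simp [ap, Fin.sum_univ_eight, Fin.sum_univ_four]
    have e3 : ∏ i, y i ^ (g b) i = ((∏ i, x i ^ (2 * b i) : ℤ) : ℝ) := by
      simp [ap, g, y, Fin.prod_univ_eight, Fin.prod_univ_four]
    rw [e3, ← e2, ← hA _ e]
  rw [Finset.sum_congr rfl h2]
  have h3 : ∀ s, (cnt m s x : ℝ) = ∑ b ∈ Finset.Nat.antidiagonalTuple 4 m,
      if ∑ i, b i ^ 2 = s then ((∏ i, x i ^ (2 * b i) : ℤ) : ℝ) else 0 := by
    intro s
    rw [← Finset.sum_filter]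
    have : cnt m s x = ∑ b ∈ (Finset.Nat.antidiagonalTuple 4 m).filter
      (fun b => ∑ i, b i ^ 2 = s), (∏ i, x i ^ (2 * b i) : ℤ) := rfl
    rw [this]
    push_cast
    rfl
  simp only [h3, Finset.mul_sum]
  rw [Finset.sum_comm]
  apply Finset.sum_congr rfl
  intro b hb
  have := sqs_spec4 m hm b hb
  simp [this]

lemma poly_zero (F : MvPolynomial (Fin 8) ℝ) (m : ℕ) (hm : m ∈ [1,2,3,5])
    (hF : F.IsHomogeneous (2 * m))
    (hl : ∑ i, pderiv i (pderiv i F) = 0)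
    (hp : ∀ σ : Equiv.Perm (Fin 8), ∀ w : Fin 8 → ℝ, eval (w ∘ σ) F = eval w F)
    (hs : ∀ i j : Fin 8, i ≠ j → ∀ w : Fin 8 → ℝ, eval (flip2 i j w) F = eval w F)
    (hT : ∀ w : Fin 8 → ℝ, eval (blk w) F = eval w F) : F = 0 := by
  have hsup := poly_zero_aux F m hm hF hl hp hs
  obtain ⟨A, hA⟩ : ∃ A : ℕ → ℝ, ∀ b : Fin 8 → ℕ, ∑ i, b i = m →
      coeff (ex (fun i => 2 * b i)) F = A (∑ i, b i ^ 2) :=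
    ⟨fun s => coeff (ex (fun i => 2 * rep m s i)) F, fun b hb => (sorted_coeff F m hm hp b hb).1⟩
  have hlap : ∀ b : Fin 8 → ℕ, ∑ i, b i + 1 = m →
      ∑ i, (2 * (b i : ℝ) + 2) * (2 * b i + 1) * A (∑ k, b k ^ 2 + 2 * b i + 1) = 0 := by
    intro b hb
    have h1 := lap_coeff F hl (fun i => 2 * b i)
    rw [← h1]
    apply Finset.sum_congr rfl
    intro i _
    have h2 := hA (fun k => b k + if k = i then 1 else 0) (by
      rw [Finset.sum_add_distrib]; simpa using hb)
    have h3 : (fun k => 2 * b k + if k = i then 2 else 0)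
        = (fun k => 2 * (b k + if k = i then 1 else 0)) := by
      funext k
      split_ifs <;> ring
    have h4 : ∑ k, (b k + if k = i then 1 else 0) ^ 2 = ∑ k, b k ^ 2 + 2 * b i + 1 := by
      have : ∀ k, (b k + if k = i then 1 else 0) ^ 2
          = b k ^ 2 + if k = i then (2 * b k + 1) else 0 := by
        intro k
        split_ifs <;> ring
      simp only [this, Finset.sum_add_distrib]
      simp
      ring
    rw [h3, h2, h4]
    push_cast
    ring
  have hev := eval_four F m A hsup hA hm
  have E1 : ∑ s ∈ sqs m, A s * cnt m s ![2,0,0,0] = ∑ s ∈ sqs m, A s * cnt m s ![1,-1,-1,-1] := by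
    rw [← hev, ← hev, ← hT]
    congr 2
    funext i
    fin_cases i <;> simp [blk] <;> norm_num
  have E2 : ∑ s ∈ sqs m, A s * cnt m s ![3,1,0,0] = ∑ s ∈ sqs m, A s * cnt m s ![1,-1,-2,-2] := by
    rw [← hev, ← hev, ← hT]
    congr 2
    funext i
    fin_cases i <;> simp [blk] <;> norm_num
  have hzero : ∀ s ∈ sqs m, A s = 0 := by
    simp only [List.mem_cons, List.not_mem_nil, or_false] at hm
    rcases hm with rfl | rfl | rfl | rfl
    · have := hlap 0 (by simp)
      simp at this
      simp [sqs, this]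
    · have := hlap ![1,0,0,0,0,0,0,0] (by simp [Fin.sum_univ_eight])
      obtain ⟨c1, c2, c3, c4⟩ := cnt_vals2
      simp [sqs, c1, c2, c3, c4] at E1
      simp [Fin.sum_univ_eight] at this
      norm_num at this
      simp [sqs]
      constructor <;> linarith
    · have l1 := hlap ![2,0,0,0,0,0,0,0] (by simp [Fin.sum_univ_eight])
      have l2 := hlap ![1,1,0,0,0,0,0,0] (by simp [Fin.sum_univ_eight])
      obtain ⟨c1, c2, c3, c4, c5, c6⟩ := cnt_vals3
      simp [sqs, c1, c2, c3, c4, c5, c6] at E1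
      simp [Fin.sum_univ_eight] at l1 l2
      norm_num at l1 l2
      simp [sqs]
      refine ⟨?_, ?_, ?_⟩ <;> linarith
    · have l1 := hlap ![4,0,0,0,0,0,0,0] (by simp [Fin.sum_univ_eight])
      have l2 := hlap ![3,1,0,0,0,0,0,0] (by simp [Fin.sum_univ_eight])
      have l3 := hlap ![2,2,0,0,0,0,0,0] (by simp [Fin.sum_univ_eight])
      have l4 := hlap ![2,1,1,0,0,0,0,0] (by simp [Fin.sum_univ_eight])
      have l5 := hlap ![1,1,1,1,0,0,0,0] (by simp [Fin.sum_univ_eight])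
      obtain ⟨⟨c1, c2, c3, c4, c5, c6, c7⟩, ⟨d1, d2, d3, d4, d5, d6, d7⟩,
        ⟨e1, e2, e3, e4, e5, e6, e7⟩, ⟨f1, f2, f3, f4, f5, f6, f7⟩⟩ := cnt_vals5
      simp [sqs, c1, c2, c3, c4, c5, c6, c7, d1, d2, d3, d4, d5, d6, d7] at E1
      simp [sqs, e1, e2, e3, e4, e5, e6, e7, f1, f2, f3, f4, f5, f6, f7] at E2
      simp [Fin.sum_univ_eight] at l1 l2 l3 l4 l5
      norm_num at l1 l2 l3 l4 l5
      simp [sqs]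
      refine ⟨?_, ?_, ?_, ?_, ?_, ?_, ?_⟩ <;> linarith
  ext d
  rw [coeff_zero]
  by_contra hd
  obtain ⟨b, hb, rfl⟩ := hsup d hd
  exact hd (by rw [hA b hb]; exact hzero _ (sorted_coeff F m hm hp b hb).2)

/-- coefficients of `p_m` for `n = 8` -/
def cf (m k : ℕ) : ℝ :=
  (-1 : ℝ) ^ k / ((Nat.factorial (2 * m - 2 * k) : ℝ) * (Nat.factorial k : ℝ) * 2 ^ k *
        ∏ l ∈ Finset.range k, (((8 : ℕ) : ℝ) + 4 * m - 4 - 2 * l))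

lemma cf_rec (m k : ℕ) (hk : k < m) :
    cf m (k + 1) * (2 * (k + 1) * (4 * m + 4 - 2 * k))
      + cf m k * ((2 * m - 2 * k) * (2 * m - 2 * k - 1)) = 0 := by
  obtain ⟨t, rfl⟩ := Nat.exists_eq_add_of_lt hk
  have h1 : 2 * (k + t + 1) - 2 * k = (2 * t + 1) + 1 := by omega
  have h2 : 2 * (k + t + 1) - 2 * (k + 1) = 2 * t := by omega
  unfold cf
  rw [h1, h2, Nat.factorial_succ, Nat.factorial_succ, Nat.factorial_succ, Finset.prod_range_succ]
  have hP : ∏ l ∈ Finset.range k, (((8 : ℕ) : ℝ) + 4 * ((k + t + 1 : ℕ) : ℝ) - 4 - 2 * l) ≠ 0 := by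
    rw [Finset.prod_ne_zero_iff]
    intro l hl
    have : (l : ℝ) < k := by exact_mod_cast Finset.mem_range.mp hl
    have ht : (0 : ℝ) ≤ t := by positivity
    have hk : (0 : ℝ) ≤ k := by positivity
    push_cast
    apply ne_of_gt
    linarith
  set P := ∏ l ∈ Finset.range k, (((8 : ℕ) : ℝ) + 4 * ((k + t + 1 : ℕ) : ℝ) - 4 - 2 * l)
  have hf1 : ((2 * t).factorial : ℝ) ≠ 0 := by positivity
  have hf2 : (k.factorial : ℝ) ≠ 0 := by positivity
  have hq : (4 * ((k : ℝ) + t + 1) + 4 - 2 * k) ≠ 0 := by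
    have ht : (0 : ℝ) ≤ t := by positivity
    have hk : (0 : ℝ) ≤ k := by positivity
    apply ne_of_gt
    linarith
  have hq' : (((8 : ℕ) : ℝ) + 4 * ((k + t + 1 : ℕ) : ℝ) - 4 - 2 * k)
      = (4 * ((k : ℝ) + t + 1) + 4 - 2 * k) := by
    push_cast; ring
  rw [hq']
  push_cast
  have hk1 : (k : ℝ) + 1 ≠ 0 := by positivity
  have ht1 : 2 * (t : ℝ) + 1 ≠ 0 := by positivity
  have ht2 : 2 * (t : ℝ) + 1 + 1 ≠ 0 := by positivity
  have e1 : (2 * ((k : ℝ) + t + 1) - 2 * k) = 2 * t + 1 + 1 := by ring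
  have e2 : (2 * ((k : ℝ) + t + 1) - 2 * k - 1) = 2 * t + 1 := by ring
  rw [e2, e1]
  generalize (4 * ((k : ℝ) + t + 1) + 4 - 2 * k) = q at *
  generalize 2 * (t : ℝ) + 1 + 1 = r at *
  generalize 2 * (t : ℝ) + 1 = r' at *
  field_simp
  ring

/-- linear form -/
def lin (v : Fin 8 → ℝ) : MvPolynomial (Fin 8) ℝ := ∑ i, C (v i) * X i

lemma pderiv_lin (v : Fin 8 → ℝ) (i : Fin 8) : pderiv i (lin v) = C (v i) := by
  simp [lin, pderiv_X, Pi.single_apply]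

lemma pderiv_rsq (i : Fin 8) : pderiv i (rsq 8) = 2 * X i := by
  simp [rsq, pderiv_X, Pi.single_apply, Derivation.leibniz_pow]

lemma pow_pred_sq (L : MvPolynomial (Fin 8) ℝ) (j : ℕ) :
    (j : MvPolynomial (Fin 8) ℝ) * (((j - 1 : ℕ) : MvPolynomial (Fin 8) ℝ) * L ^ (j - 1 - 1)) * L
      = j * (j - 1) * L ^ (j - 1) := by
  rcases j with _ | _ | j
  · simp
  · simp
  · simp
    ring

lemma lap_term (v : Fin 8 → ℝ) (k j : ℕ) :
    ∑ i, pderiv i (pderiv i (rsq 8 ^ k * lin v ^ j))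
      = C (k * (4 * k + 12 + 4 * j) : ℝ) * (rsq 8 ^ (k - 1) * lin v ^ j)
        + C (j * (j - 1) * ∑ i, v i ^ 2 : ℝ) * (rsq 8 ^ k * lin v ^ (j - 2)) := by
  set R := rsq 8 with hR
  set L := lin v with hL
  have hi : ∀ i, pderiv i (pderiv i (R ^ k * L ^ j))
      = ((k : MvPolynomial (Fin 8) ℝ) * (((k - 1 : ℕ) : MvPolynomial (Fin 8) ℝ) * R ^ (k - 1 - 1))) * 4 * L ^ j * (X i ^ 2)
        + 2 * (k : MvPolynomial (Fin 8) ℝ) * R ^ (k - 1) * L ^ j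
        + 4 * (k : MvPolynomial (Fin 8) ℝ) * (j : MvPolynomial (Fin 8) ℝ) * R ^ (k - 1) * L ^ (j - 1) * (C (v i) * X i)
        + (j : MvPolynomial (Fin 8) ℝ) * ((j - 1 : ℕ) : MvPolynomial (Fin 8) ℝ) * R ^ k * L ^ (j - 1 - 1) * C (v i ^ 2) := by
    intro i
    have h2 : pderiv i (2 : MvPolynomial (Fin 8) ℝ) = 0 := by
      simpa using (pderiv i).map_natCast 2
    simp only [pderiv_mul, pderiv_pow, map_add, Derivation.map_natCast, hR, hL, pderiv_lin,
      pderiv_rsq, pderiv_C, pderiv_X_self, C_pow, h2]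
    ring
  have hX : ∑ i : Fin 8, (X i : MvPolynomial (Fin 8) ℝ) ^ 2 = R := rfl
  have hvX : ∑ i : Fin 8, C (v i) * (X i : MvPolynomial (Fin 8) ℝ) = L := rfl
  simp only [hi, Finset.sum_add_distrib, ← Finset.mul_sum, hX, hvX, ← map_sum]
  have a1 := pow_pred_sq R k
  have a2 : (j : MvPolynomial (Fin 8) ℝ) * L ^ (j - 1) * L = j * L ^ j := by
    rcases j with _ | j
    · simp
    · simp; ring
  have a3 : (j : MvPolynomial (Fin 8) ℝ) * ((j - 1 : ℕ) : MvPolynomial (Fin 8) ℝ)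
      = j * (j - 1) := by
    rcases j with _ | j <;> simp
  have a4 : j - 1 - 1 = j - 2 := by omega
  have a5 : ∑ i : Fin 8, 2 * (k : MvPolynomial (Fin 8) ℝ) * R ^ (k - 1) * L ^ j
      = 16 * (k * R ^ (k - 1) * L ^ j) := by
    simp only [Finset.sum_const, Finset.card_univ, Fintype.card_fin, nsmul_eq_mul]
    push_cast
    ring
  rw [a4, a3]
  simp only [Finset.sum_const, Finset.card_univ, Fintype.card_fin, nsmul_eq_mul]
  have c4 : (C (4 : ℝ) : MvPolynomial (Fin 8) ℝ) = 4 := by simpa using map_natCast (C (σ := Fin 8) (R := ℝ)) 4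
  have c12 : (C (12 : ℝ) : MvPolynomial (Fin 8) ℝ) = 12 := by simpa using map_natCast (C (σ := Fin 8) (R := ℝ)) 12
  simp only [map_mul, map_add, map_sub, map_one, map_natCast, c4, c12]
  push_cast
  linear_combination (4 * L ^ j) * a1 + (4 * k * R ^ (k - 1)) * a2

/-- zonal polynomial -/
def zon (m : ℕ) (ρ : ℝ) (v : Fin 8 → ℝ) : MvPolynomial (Fin 8) ℝ :=
  ∑ k ∈ Finset.range (m + 1), C (cf m k * ρ ^ k) * (rsq 8 ^ k * lin v ^ (2 * m - 2 * k))

lemma comb_zero (a b c d : ℝ) (M : MvPolynomial (Fin 8) ℝ) (h : a * b + c * d = 0) :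
    C a * (C b * M) + C c * (C d * M) = 0 := by
  have h1 : (C (a * b + c * d) : MvPolynomial (Fin 8) ℝ) = 0 := by rw [h, C_0]
  simp only [C_add, C_mul] at h1
  linear_combination M * h1

lemma lap_zon (m : ℕ) (ρ : ℝ) (v : Fin 8 → ℝ) (hv : ∑ i, v i ^ 2 = ρ) :
    ∑ i, pderiv i (pderiv i (zon m ρ v)) = 0 := by
  unfold zon
  simp only [map_sum, pderiv_C_mul]
  rw [Finset.sum_comm]
  simp only [← Finset.mul_sum, lap_term, hv, mul_add, Finset.sum_add_distrib]
  rw [Finset.sum_range_succ', Finset.sum_range_succ _ m]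
  simp only [Nat.cast_zero, zero_mul, map_zero, mul_zero, add_zero, Nat.sub_self]
  rw [← Finset.sum_add_distrib]
  apply Finset.sum_eq_zero
  intro k hk
  rw [Finset.mem_range] at hk
  have e1 : 2 * m - 2 * (k + 1) = 2 * m - 2 * k - 2 := by omega
  have e2 : k + 1 - 1 = k := rfl
  have e3 : ((2 * m - 2 * k : ℕ) : ℝ) = 2 * m - 2 * k := by
    rw [Nat.cast_sub (by omega)]; push_cast; ring
  have e4 : ((2 * m - 2 * k - 2 : ℕ) : ℝ) = 2 * m - 2 * k - 2 := by
    rw [Nat.cast_sub (by omega), e3]; push_cast; ring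
  rw [e1, e2, e3, e4]
  have := cf_rec m k hk
  apply comb_zero
  push_cast
  linear_combination (ρ ^ (k + 1)) * this

lemma rsq_hom : (rsq 8).IsHomogeneous 2 := by
  apply IsHomogeneous.sum
  intro i _
  exact isHomogeneous_X_pow i 2

lemma lin_hom (v : Fin 8 → ℝ) : (lin v).IsHomogeneous 1 := by
  apply IsHomogeneous.sum
  intro i _
  exact isHomogeneous_C_mul_X (v i) i

lemma zon_hom (m : ℕ) (ρ : ℝ) (v : Fin 8 → ℝ) : (zon m ρ v).IsHomogeneous (2 * m) := by
  apply IsHomogeneous.sum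
  intro k hk
  rw [Finset.mem_range] at hk
  have h := ((rsq_hom.pow k).mul ((lin_hom v).pow (2 * m - 2 * k)))
  have e : 2 * k + 1 * (2 * m - 2 * k) = 2 * m := by omega
  rw [e] at h
  simpa using (isHomogeneous_C (Fin 8) (cf m k * ρ ^ k)).mul h

/-- zonal function -/
def zf (m : ℕ) (ρ q t : ℝ) : ℝ :=
  ∑ k ∈ Finset.range (m + 1), cf m k * ρ ^ k * (q ^ k * t ^ (2 * m - 2 * k))

lemma eval_zon (m : ℕ) (ρ : ℝ) (v w : Fin 8 → ℝ) :
    eval w (zon m ρ v) = zf m ρ (∑ i, w i ^ 2) (∑ i, v i * w i) := by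
  simp [zon, zf, rsq, lin]

lemma inv_aux (m : ℕ) (ρ : ℝ) (S : Finset (Fin 8 → ℝ)) (φ ψ : (Fin 8 → ℝ) → (Fin 8 → ℝ))
    (hφ : ∀ v ∈ S, φ v ∈ S) (hψ : ∀ v ∈ S, ψ v ∈ S) (h1 : ∀ v, φ (ψ v) = v)
    (h2 : ∀ v, ψ (φ v) = v) (h3 : ∀ v w, ∑ i, v i * φ w i = ∑ i, ψ v i * w i)
    (h4 : ∀ w, ∑ i, φ w i ^ 2 = ∑ i, w i ^ 2) (w : Fin 8 → ℝ) :
    eval (φ w) (∑ v ∈ S, zon m ρ v) = eval w (∑ v ∈ S, zon m ρ v) := by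
  simp only [map_sum, eval_zon, h3, h4]
  exact Finset.sum_nbij' ψ φ hψ hφ (fun v _ => h1 v) (fun v _ => h2 v) (fun _ _ => rfl)

lemma flip2_flip2 (i j : Fin 8) (v : Fin 8 → ℝ) : flip2 i j (flip2 i j v) = v := by
  funext k
  simp only [flip2]
  split_ifs <;> simp

lemma blk_blk (v : Fin 8 → ℝ) : blk (blk v) = v := by
  funext k
  fin_cases k <;> simp [blk] <;> ring

lemma shell_sum (m : ℕ) (hm : m ∈ [1,2,3,5]) (ρ : ℝ) (S : Finset (Fin 8 → ℝ))
    (hρ : ∀ v ∈ S, ∑ i, v i ^ 2 = ρ)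
    (hp : ∀ σ : Equiv.Perm (Fin 8), ∀ v ∈ S, v ∘ σ ∈ S)
    (hs : ∀ i j, i ≠ j → ∀ v ∈ S, flip2 i j v ∈ S)
    (hT : ∀ v ∈ S, blk v ∈ S) (w : Fin 8 → ℝ) :
    ∑ v ∈ S, zf m ρ (∑ i, w i ^ 2) (∑ i, v i * w i) = 0 := by
  have : ∑ v ∈ S, zon m ρ v = 0 := by
    apply poly_zero _ m hm
    · exact IsHomogeneous.sum _ _ _ (fun v _ => zon_hom m ρ v)
    · simp only [map_sum]
      rw [Finset.sum_comm]
      exact Finset.sum_eq_zero (fun v hv => lap_zon m ρ v (hρ v hv))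
    · intro σ w
      refine inv_aux m ρ S (fun w => w ∘ σ) (fun w => w ∘ σ.symm) (hp σ) (hp σ.symm)
        ?_ ?_ ?_ ?_ w
      · intro v; funext i; simp
      · intro v; funext i; simp
      · intro v w
        rw [← Equiv.sum_comp σ.symm]
        simp
      · intro w
        exact Equiv.sum_comp σ (fun i => w i ^ 2)
    · intro i j hij w
      refine inv_aux m ρ S (flip2 i j) (flip2 i j) (hs i j hij) (hs i j hij)
        (flip2_flip2 i j) (flip2_flip2 i j) ?_ ?_ w
      · intro v w
        apply Finset.sum_congr rfl
        intro k _
        simp only [flip2]; ring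
      · intro w
        apply Finset.sum_congr rfl
        intro k _
        simp only [flip2]
        split_ifs <;> ring
    · intro w
      refine inv_aux m ρ S blk blk hT hT blk_blk blk_blk ?_ ?_ w
      · intro v w
        simp [Fin.sum_univ_eight, blk]
        ring
      · intro w
        simp [Fin.sum_univ_eight, blk]
        ring
  have h := congrArg (eval w) this
  simpa only [map_sum, eval_zon, map_zero] using h

/-- the lattice in coordinates -/
def E8f : Set (Fin 8 → ℝ) :=
  {x | ((∀ i, ∃ z : ℤ, x i = (z : ℝ)) ∨ (∀ i, ∃ z : ℤ, x i = (z : ℝ) + 1 / 2)) ∧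
    ∃ z : ℤ, (∑ i, x i) = 2 * (z : ℝ)}

lemma E8f_finite (K : ℕ) : {x | x ∈ E8f ∧ ∑ i, x i ^ 2 ≤ (K : ℝ)}.Finite := by
  classical
  refine Set.Finite.subset (Finset.finite_toSet ((Fintype.piFinset
    (fun _ : Fin 8 => Finset.Icc (-(2 * K + 2 : ℤ)) (2 * K + 2))).image
      (fun z : Fin 8 → ℤ => fun i => (z i : ℝ) / 2))) ?_
  rintro x ⟨⟨hx, _⟩, hK⟩
  have hz : ∀ i, ∃ z : ℤ, x i = (z : ℝ) / 2 := by
    intro i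
    rcases hx with hx | hx
    · obtain ⟨z, hz⟩ := hx i
      exact ⟨2 * z, by rw [hz]; push_cast; ring⟩
    · obtain ⟨z, hz⟩ := hx i
      exact ⟨2 * z + 1, by rw [hz]; push_cast; ring⟩
  choose z hz using hz
  simp only [Finset.coe_image, Set.mem_image, Finset.mem_coe, Fintype.mem_piFinset, Finset.mem_Icc]
  refine ⟨z, fun i => ?_, by funext i; exact (hz i).symm⟩
  have h1 : x i ^ 2 ≤ K := le_trans
    (Finset.single_le_sum (f := fun i => x i ^ 2) (fun j _ => sq_nonneg (x j)) (Finset.mem_univ i)) hK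
  have hK0 : (0 : ℝ) ≤ K := by positivity
  rw [hz i] at h1
  have h2 : (z i : ℝ) ≤ 2 * K + 2 := by nlinarith
  have h3 : (-(2 * K + 2) : ℝ) ≤ z i := by nlinarith
  constructor
  · exact_mod_cast h3
  · exact_mod_cast h2

lemma E8f_perm (σ : Equiv.Perm (Fin 8)) (v : Fin 8 → ℝ) (hv : v ∈ E8f) : v ∘ σ ∈ E8f := by
  obtain ⟨h1, h2⟩ := hv
  refine ⟨?_, ?_⟩
  · rcases h1 with h1 | h1
    · exact Or.inl fun i => h1 (σ i)
    · exact Or.inr fun i => h1 (σ i)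
  · have : ∑ i, (v ∘ σ) i = ∑ i, v i := Equiv.sum_comp σ v
    rw [this]
    exact h2

lemma E8f_flip (i j : Fin 8) (hij : i ≠ j) (v : Fin 8 → ℝ) (hv : v ∈ E8f) :
    flip2 i j v ∈ E8f := by
  obtain ⟨h1, h2⟩ := hv
  have hsum : ∑ k, flip2 i j v k = ∑ k, v k - 2 * (v i + v j) := by
    have : ∀ k, flip2 i j v k = v k - 2 * ((if k = i then v k else 0) + if k = j then v k else 0) := by
      intro k
      simp only [flip2]
      by_cases hi : k = i
      · have : k ≠ j := by rw [hi]; exact hij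
        simp [hi, hij]; ring
      · by_cases hj : k = j
        · simp [hj, hij.symm]; ring
        · simp [hi, hj]
    simp only [this, Finset.sum_sub_distrib, ← Finset.mul_sum, Finset.sum_add_distrib]
    simp
  obtain ⟨s, hs⟩ := h2
  rcases h1 with h1 | h1
  · refine ⟨Or.inl fun k => ?_, ?_⟩
    · obtain ⟨z, hz⟩ := h1 k
      simp only [flip2, hz]
      split_ifs
      · exact ⟨-z, by push_cast; ring⟩
      · exact ⟨z, by ring⟩
    · obtain ⟨a, ha⟩ := h1 i
      obtain ⟨b, hb⟩ := h1 j
      exact ⟨s - (a + b), by rw [hsum, hs, ha, hb]; push_cast; ring⟩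
  · refine ⟨Or.inr fun k => ?_, ?_⟩
    · obtain ⟨z, hz⟩ := h1 k
      simp only [flip2, hz]
      split_ifs
      · exact ⟨-z - 1, by push_cast; ring⟩
      · exact ⟨z, by ring⟩
    · obtain ⟨a, ha⟩ := h1 i
      obtain ⟨b, hb⟩ := h1 j
      exact ⟨s - (a + b + 1), by rw [hsum, hs, ha, hb]; push_cast; ring⟩

lemma E8f_blk (v : Fin 8 → ℝ) (hv : v ∈ E8f) : blk v ∈ E8f := by
  obtain ⟨h1, s, hs⟩ := hv
  -- both block sums are integers `p`, `q` with `p + q = 2 s`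
  obtain ⟨p, hp⟩ : ∃ p : ℤ, v 0 + v 1 + v 2 + v 3 = p := by
    rcases h1 with h1 | h1
    · choose z hz using h1
      exact ⟨z 0 + z 1 + z 2 + z 3, by simp only [hz]; push_cast; ring⟩
    · choose z hz using h1
      exact ⟨z 0 + z 1 + z 2 + z 3 + 2, by simp only [hz]; push_cast; ring⟩
  have hq : v 4 + v 5 + v 6 + v 7 = 2 * (s : ℝ) - p := by
    rw [← hs, ← hp, Fin.sum_univ_eight]; ring
  have hsum : ∑ i, blk v i = 2 * ((-s : ℤ) : ℝ) := by
    have : ∑ i, blk v i = - ∑ i, v i := by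
      simp [Fin.sum_univ_eight, blk]; ring
    rw [this, hs]; push_cast; ring
  have hb : ∀ i, blk v i = v i - p / 2 ∨ blk v i = v i + p / 2 - s := by
    intro i
    simp only [blk, hp, hq]
    split_ifs
    · left; ring
    · right; ring
  refine ⟨?_, -s, hsum⟩
  rcases Int.even_or_odd p with ⟨r, hr⟩ | ⟨r, hr⟩
  · have hr' : (p : ℝ) = r + r := by exact_mod_cast hr
    rcases h1 with h1 | h1
    · left
      intro i
      obtain ⟨z, hz⟩ := h1 i
      rcases hb i with h | h
      · exact ⟨z - r, by rw [h, hz, hr']; push_cast; ring⟩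
      · exact ⟨z + r - s, by rw [h, hz, hr']; push_cast; ring⟩
    · right
      intro i
      obtain ⟨z, hz⟩ := h1 i
      rcases hb i with h | h
      · exact ⟨z - r, by rw [h, hz, hr']; push_cast; ring⟩
      · exact ⟨z + r - s, by rw [h, hz, hr']; push_cast; ring⟩
  · have hr' : (p : ℝ) = 2 * r + 1 := by exact_mod_cast hr
    rcases h1 with h1 | h1
    · right
      intro i
      obtain ⟨z, hz⟩ := h1 i
      rcases hb i with h | h
      · exact ⟨z - r - 1, by rw [h, hz, hr']; push_cast; ring⟩
      · exact ⟨z + r - s, by rw [h, hz, hr']; push_cast; ring⟩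
    · left
      intro i
      obtain ⟨z, hz⟩ := h1 i
      rcases hb i with h | h
      · exact ⟨z - r, by rw [h, hz, hr']; push_cast; ring⟩
      · exact ⟨z + r + 1 - s, by rw [h, hz, hr']; push_cast; ring⟩

lemma blk_sq (w : Fin 8 → ℝ) : ∑ i, blk w i ^ 2 = ∑ i, w i ^ 2 := by
  simp [Fin.sum_univ_eight, blk]
  ring

lemma pm_term (m : ℕ) (A B t : ℝ) (hA : A ≠ 0) (hB : B ≠ 0) :
    pmVal 8 m (t / (A * B)) * A ^ (2 * m) * B ^ (2 * m) = zf m (A ^ 2) (B ^ 2) t := by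
  unfold pmVal zf
  rw [Finset.sum_mul, Finset.sum_mul]
  apply Finset.sum_congr rfl
  intro k hk
  rw [Finset.mem_range] at hk
  have h : ∀ y : ℝ, y ^ (2 * m) = y ^ (2 * m - 2 * k) * (y ^ 2) ^ k := by
    intro y
    rw [← pow_mul, ← pow_add]
    congr 1
    omega
  rw [h A, h B, div_pow, mul_pow]
  unfold cf
  have h1 : A ^ (2 * m - 2 * k) ≠ 0 := pow_ne_zero _ hA
  have h2 : B ^ (2 * m - 2 * k) ≠ 0 := pow_ne_zero _ hB
  generalize A ^ (2 * m - 2 * k) = a at *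
  generalize B ^ (2 * m - 2 * k) = b at *
  have h3 : t ^ (2 * m - 2 * k) / (a * b) * (a * b) = t ^ (2 * m - 2 * k) := by
    field_simp
  rw [div_mul_eq_mul_div, div_mul_eq_mul_div, div_mul_eq_mul_div, div_mul_eq_mul_div]
  congr 1
  linear_combination (-1) ^ k * (A ^ 2) ^ k * (B ^ 2) ^ k * h3

lemma inner_sum (m : ℕ) (hm : m ∈ [1,2,3,5]) (ρ : ℝ) (U : Finset (Fin 8 → ℝ))
    (hU : ∀ v, v ∈ E8f → ∑ i, v i ^ 2 = ρ → v ∈ U) (P : (Fin 8 → ℝ) → Prop) [DecidablePred P]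
    (hP : ∀ v, P v ↔ v ∈ E8f ∧ ∑ i, v i ^ 2 = ρ) (w : Fin 8 → ℝ) :
    ∑ v ∈ U with P v, zf m ρ (∑ i, w i ^ 2) (∑ i, v i * w i) = 0 := by
  have hmem : ∀ v, v ∈ U.filter P ↔ v ∈ E8f ∧ ∑ i, v i ^ 2 = ρ := by
    intro v
    rw [Finset.mem_filter, hP]
    exact ⟨fun h => h.2, fun h => ⟨hU v h.1 h.2, h⟩⟩
  apply shell_sum m hm
  · intro v hv
    exact ((hmem v).mp hv).2
  · intro σ v hv
    rw [hmem] at hv ⊢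
    exact ⟨E8f_perm σ v hv.1, by rw [← hv.2]; exact Equiv.sum_comp σ (fun i => v i ^ 2)⟩
  · intro i j hij v hv
    rw [hmem] at hv ⊢
    refine ⟨E8f_flip i j hij v hv.1, ?_⟩
    rw [← hv.2]
    apply Finset.sum_congr rfl
    intro k _
    simp only [flip2]
    split_ifs <;> ring
  · intro v hv
    rw [hmem] at hv ⊢
    exact ⟨E8f_blk v hv.1, by rw [← hv.2, blk_sq]⟩

/-- the q-expansion coefficients of `Θ_{m,m,E₈}` vanish for
`m ∈ {1,2,3,5}`. -/
theorem statement17 (m : ℕ) (hm : m ∈ ({1, 2, 3, 5} : Set ℕ)) (k : ℕ) :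
    ∑' p : {p : E 8 × E 8 // p.1 ∈ E8set ∧ p.2 ∈ E8set ∧ p.1 ≠ 0 ∧ p.2 ≠ 0 ∧
        ‖p.1‖ ^ 2 + ‖p.2‖ ^ 2 = (k : ℝ)},
      pmVal 8 m (⟪p.1.1, p.1.2⟫ / (‖p.1.1‖ * ‖p.1.2‖)) *
        ‖p.1.1‖ ^ (2 * m) * ‖p.1.2‖ ^ (2 * m) = 0 := by
  classical
  have hm' : m ∈ [1,2,3,5] := by simpa using hm
  let Q : E 8 × E 8 → Prop := fun p => p.1 ∈ E8set ∧ p.2 ∈ E8set ∧ p.1 ≠ 0 ∧ p.2 ≠ 0 ∧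
        ‖p.1‖ ^ 2 + ‖p.2‖ ^ 2 = (k : ℝ)
  let f : E 8 × E 8 → ℝ := fun p => pmVal 8 m (⟪p.1, p.2⟫ / (‖p.1‖ * ‖p.2‖)) *
        ‖p.1‖ ^ (2 * m) * ‖p.2‖ ^ (2 * m)
  change ∑' p : {p | Q p}, f p = 0
  rw [tsum_subtype {p | Q p} f]
  let U : Finset (Fin 8 → ℝ) := (E8f_finite k).toFinset
  have hUmem : ∀ v, v ∈ U ↔ v ∈ E8f ∧ ∑ i, v i ^ 2 ≤ (k : ℝ) := fun v => by
    simp [U]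
  let e : (Fin 8 → ℝ) ↪ E 8 := (WithLp.equiv 2 (Fin 8 → ℝ)).symm.toEmbedding
  have hnorm : ∀ v : Fin 8 → ℝ, ‖e v‖ ^ 2 = ∑ i, v i ^ 2 := fun v => by
    rw [EuclideanSpace.real_norm_sq_eq]; rfl
  have hnorm' : ∀ v : E 8, ‖v‖ ^ 2 = ∑ i, v i ^ 2 := fun v => by
    rw [EuclideanSpace.real_norm_sq_eq]
  have hinner : ∀ v w : Fin 8 → ℝ, ⟪e v, e w⟫ = ∑ i, v i * w i := fun v w => by
    rw [PiLp.inner_apply]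
    apply Finset.sum_congr rfl
    intro i _
    simp [e, mul_comm]
  have hE : ∀ v : Fin 8 → ℝ, e v ∈ E8set ↔ v ∈ E8f := fun v => Iff.rfl
  have hin : ∀ x : E 8, x ∈ E8set → ‖x‖ ^ 2 ≤ k → x ∈ U.map e := by
    intro x hx hk
    rw [Finset.mem_map]
    exact ⟨fun i => x i, (hUmem _).mpr ⟨hx, by rw [← hnorm' x]; exact hk⟩, rfl⟩
  rw [tsum_eq_sum (s := (U.map e) ×ˢ (U.map e))]
  swap
  · intro p hp
    apply Set.indicator_of_notMem
    rintro ⟨h1, h2, _, _, h5⟩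
    apply hp
    rw [Finset.mem_product]
    exact ⟨hin _ h1 (by nlinarith [sq_nonneg ‖p.2‖]), hin _ h2 (by nlinarith [sq_nonneg ‖p.1‖])⟩
  rw [Finset.sum_product_right, Finset.sum_map]
  apply Finset.sum_eq_zero
  intro w hw
  rw [Finset.sum_map]
  simp only [Set.indicator_apply, Set.mem_setOf_eq]
  rw [← Finset.sum_filter]
  by_cases hw0 : e w = 0
  · rw [Finset.filter_false_of_mem]
    · simp
    · rintro v _ ⟨_, _, _, h4, _⟩
      exact h4 hw0
  by_cases hρ : (k : ℝ) - ∑ i, w i ^ 2 ≤ 0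
  · rw [Finset.filter_false_of_mem]
    · simp
    · rintro v _ ⟨_, _, h3, _, h5⟩
      simp only [hnorm w] at h5
      have : 0 < ‖e v‖ ^ 2 := by positivity
      linarith
  push Not at hρ
  have hQ : ∀ v, Q (e v, e w) ↔ v ∈ E8f ∧ ∑ i, v i ^ 2 = (k : ℝ) - ∑ i, w i ^ 2 := by
    intro v
    constructor
    · rintro ⟨h1, _, _, _, h5⟩
      simp only [hnorm] at h5
      exact ⟨h1, by linarith⟩
    · rintro ⟨h1, h2⟩
      refine ⟨h1, ((hUmem w).mp hw).1, ?_, hw0, ?_⟩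
      · intro h
        have h0 := hnorm v
        simp only at h
        rw [h, h2] at h0
        simp at h0
        linarith
      · simp only [hnorm, h2]
        ring
  rw [← inner_sum m hm' ((k : ℝ) - ∑ i, w i ^ 2) U
    (fun v h1 h2 => (hUmem v).mpr ⟨h1, by
      rw [h2]
      have : 0 ≤ ∑ i, w i ^ 2 := Finset.sum_nonneg (fun i _ => sq_nonneg (w i))
      linarith⟩)
    (fun v => Q (e v, e w)) hQ w]
  apply Finset.sum_congr rfl
  intro v hv
  have hv2 := (Finset.mem_filter.mp hv).2
  have hv0 : e v ≠ 0 := hv2.2.2.1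
  have h2 := ((hQ v).mp hv2).2
  simp only [f]
  rw [pm_term m _ _ _ (norm_ne_zero_iff.mpr hv0) (norm_ne_zero_iff.mpr hw0), hnorm, hnorm, h2,
    hinner]

end Heat
end
end

section
/- Let Λ := (1/√2)·E₈ ⊂ ℝ⁸ be the E₈ lattice rescaled so that its minimal vectors have squared norm 1, and take n = 8 in the definition of p_m. Then for every integer k ≥ 0: Σ_{(v,w)∈Λ×Λ, v≠0, w≠0, ‖v‖²+‖w‖²=k} p₄(⟨v,w⟩/(‖v‖‖w‖)) · ‖v‖⁸‖w‖⁸ = (3/896) · c_k, where Σ_{k≥0} c_k q^k is the power-series expansion of Δ(q)² := q² Π_{j≥1} (1−q^j)^{48}. (Equivalently, Θ_{4,4,E₈} = (3/896)·Δ(τ)² where Δ is the modular discriminant.) -/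
noncomputable section

open MvPolynomial MeasureTheory Finset
open scoped RealInnerProductSpace Manifold

namespace HeatAux

lemma hasSum_pi_prod : ∀ (n : ℕ) (f : Fin n → ℤ → ℂ), (∀ i, Summable (fun m => ‖f i m‖)) →
    Summable (fun z : Fin n → ℤ => ‖∏ i, f i (z i)‖) ∧
      ∑' z : Fin n → ℤ, ∏ i, f i (z i) = ∏ i, ∑' m, f i m := by
  intro n
  induction n with
  | zero =>
    intro f _
    refine ⟨Summable.of_finite, ?_⟩
    rw [tsum_fintype]
    simp
  | succ n ih =>
    intro f hf
    obtain ⟨h1, h2⟩ := ih (fun i => f i.succ) (fun i => hf i.succ)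
    have hs := (summable_mul_of_summable_norm (hf 0) h1)
    have hsn := ((hf 0).mul_norm h1)
    have e : (fun p : ℤ × (Fin n → ℤ) => f 0 p.1 * ∏ i, f (Fin.succ i) (p.2 i)) =
        (fun z : Fin (n+1) → ℤ => ∏ i, f i (z i)) ∘ (Fin.consEquiv (fun _ : Fin (n+1) => ℤ)) := by
      funext p
      simp [Fin.prod_univ_succ, Fin.consEquiv]
    constructor
    · rw [← (Fin.consEquiv (fun _ : Fin (n+1) => ℤ)).summable_iff]
      refine hsn.congr ?_
      intro p
      exact congrArg norm (congrFun e p)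
    · rw [← (Fin.consEquiv (fun _ : Fin (n+1) => ℤ)).tsum_eq, Fin.prod_univ_succ, ← h2,
        tsum_mul_tsum_of_summable_norm (hf 0) h1]
      exact tsum_congr fun p => (congrFun e p).symm

/-- Index type for the `E₈` lattice. -/
def V : Type := {p : Bool × (Fin 8 → ℤ) // Even (∑ i, p.2 i)}

/-- coordinates -/
def co' (p : Bool × (Fin 8 → ℤ)) (i : Fin 8) : ℝ := p.2 i + if p.1 then 1 / 2 else 0

def co (v : V) (i : Fin 8) : ℝ := co' v.1 i

def sq (v : V) : ℝ := ∑ i, co v i ^ 2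

def ip (v : V) (w : Fin 8 → ℝ) : ℝ := ∑ i, co v i * w i

def eterm (w : Fin 8 → ℝ) (s τ : ℂ) (p : Bool × (Fin 8 → ℤ)) : ℂ :=
  ∏ i, Complex.exp (Real.pi * Complex.I * τ * (co' p i : ℂ) ^ 2 +
    2 * Real.pi * Complex.I * s * (co' p i : ℂ) * (w i : ℂ))

lemma eterm_eq (w : Fin 8 → ℝ) (s τ : ℂ) (v : V) :
    eterm w s τ v.1 = Complex.exp (Real.pi * Complex.I * τ * (sq v : ℂ) +
      2 * Real.pi * Complex.I * s * (ip v w : ℂ)) := by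
  rw [eterm, ← Complex.exp_sum]
  congr 1
  simp only [sq, ip, co, Finset.sum_add_distrib, Complex.ofReal_sum, Finset.mul_sum,
    Complex.ofReal_mul, Complex.ofReal_pow, mul_assoc]

/-- one dimensional factors -/
def phi (a : ℝ) (s τ : ℂ) (c b : Bool) : ℂ :=
  (if b then Complex.exp (Real.pi * Complex.I * τ / 4 + Real.pi * Complex.I * s * a) else 1) *
    jacobiTheta₂ (s * a + (if b then τ / 2 else 0) + (if c then 1 / 2 else 0)) τ

def phiterm (a : ℝ) (s τ : ℂ) (c b : Bool) (m : ℤ) : ℂ :=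
  (if c then (-1 : ℂ) ^ m else 1) *
  Complex.exp (Real.pi * Complex.I * τ * ((m + if b then 1 / 2 else 0 : ℝ) : ℂ) ^ 2 +
    2 * Real.pi * Complex.I * s * ((m + if b then 1 / 2 else 0 : ℝ) : ℂ) * (a : ℂ))

lemma exp_half (m : ℤ) : Complex.exp (2 * Real.pi * Complex.I * m * (1 / 2)) = (-1 : ℂ) ^ m := by
  rw [← Complex.exp_pi_mul_I, ← Complex.exp_int_mul]
  congr 1
  ring

lemma phiterm_eq (a : ℝ) (s τ : ℂ) (c b : Bool) (m : ℤ) : phiterm a s τ c b m =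
    (if b then Complex.exp (Real.pi * Complex.I * τ / 4 + Real.pi * Complex.I * s * a) else 1) *
    jacobiTheta₂_term m (s * a + (if b then τ / 2 else 0) + (if c then 1 / 2 else 0)) τ := by
  unfold phiterm jacobiTheta₂_term
  have hc : (if c then (-1 : ℂ) ^ m else 1) =
      Complex.exp (2 * Real.pi * Complex.I * m * (if c then 1 / 2 else 0)) := by
    cases c
    · simp
    · simp only [if_true]; rw [exp_half]
  have hb : (if b then Complex.exp (Real.pi * Complex.I * τ / 4 + Real.pi * Complex.I * s * a)
      else 1) = Complex.exp (if b then (Real.pi * Complex.I * τ / 4 + Real.pi * Complex.I * s * a)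
      else 0) := by
    cases b <;> simp
  rw [hc, hb, ← Complex.exp_add, ← Complex.exp_add]
  congr 1
  cases b <;> cases c <;> simp <;> ring

lemma summable_phiterm (a : ℝ) (s : ℂ) {τ : ℂ} (hτ : 0 < τ.im) (c b : Bool) :
    Summable (fun m => ‖phiterm a s τ c b m‖) := by
  simp_rw [phiterm_eq, norm_mul]
  exact (((summable_jacobiTheta₂_term_iff _ τ).mpr hτ).norm).mul_left _

lemma tsum_phiterm (a : ℝ) (s τ : ℂ) (c b : Bool) :
    ∑' m, phiterm a s τ c b m = phi a s τ c b := by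
  simp_rw [phiterm_eq, tsum_mul_left]
  rfl

lemma prod_neg_one (z : Fin 8 → ℤ) : (∏ i, (-1 : ℂ) ^ (z i)) = if Even (∑ i, z i) then 1 else -1 := by
  have : (∏ i, (-1 : ℂ) ^ (z i)) = (-1 : ℂ) ^ (∑ i, z i) := by
    rw [Fin.sum_univ_eight, Fin.prod_univ_eight]
    simp only [zpow_add₀ (show (-1 : ℂ) ≠ 0 by norm_num)]
  rw [this]
  split_ifs with h
  · exact h.neg_one_zpow
  · exact (Int.not_even_iff_odd.mp h).neg_one_zpow

lemma eterm_ind (w : Fin 8 → ℝ) (s τ : ℂ) (b : Bool) (z : Fin 8 → ℤ) :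
    (if Even (∑ i, z i) then eterm w s τ (b, z) else 0) =
      1 / 2 * ((∏ i, phiterm (w i) s τ false b (z i)) + ∏ i, phiterm (w i) s τ true b (z i)) := by
  have h1 : eterm w s τ (b, z) = ∏ i, phiterm (w i) s τ false b (z i) := by
    simp [eterm, phiterm, co']
  have h2 : ∀ i, phiterm (w i) s τ true b (z i) =
      (-1 : ℂ) ^ (z i) * phiterm (w i) s τ false b (z i) := by
    intro i
    simp [phiterm]
  simp only [h2, h1, Finset.prod_mul_distrib, prod_neg_one]
  split_ifs <;> ring

lemma summable_eterm (w : Fin 8 → ℝ) (s : ℂ) {τ : ℂ} (hτ : 0 < τ.im) :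
    Summable (fun p : Bool × (Fin 8 → ℤ) => ‖eterm w s τ p‖) := by
  have : ∀ b, Summable (fun z : Fin 8 → ℤ => ‖eterm w s τ (b, z)‖) := by
    intro b
    have h := (hasSum_pi_prod 8 (fun i => phiterm (w i) s τ false b)
      (fun i => summable_phiterm _ _ hτ _ _)).1
    refine h.congr fun z => ?_
    simp [eterm, phiterm, co']
  rw [summable_prod_of_nonneg (fun _ => norm_nonneg _)]
  exact ⟨this, Summable.of_finite⟩

def F (w : Fin 8 → ℝ) (s τ : ℂ) : ℂ := ∑' v : V, eterm w s τ v.1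

lemma summable_V (w : Fin 8 → ℝ) (s : ℂ) {τ : ℂ} (hτ : 0 < τ.im) :
    Summable (fun v : V => ‖eterm w s τ v.1‖) :=
  (summable_eterm w s hτ).subtype {p : Bool × (Fin 8 → ℤ) | Even (∑ i, p.2 i)}

lemma F_eq (w : Fin 8 → ℝ) (s : ℂ) {τ : ℂ} (hτ : 0 < τ.im) :
    F w s τ = 1 / 2 * ((∏ i, phi (w i) s τ false false) + (∏ i, phi (w i) s τ true false) +
      (∏ i, phi (w i) s τ false true) + (∏ i, phi (w i) s τ true true)) := by
  have h1 : F w s τ = ∑' p : Bool × (Fin 8 → ℤ),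
      (if Even (∑ i, p.2 i) then eterm w s τ p else 0) := by
    have := tsum_subtype {p : Bool × (Fin 8 → ℤ) | Even (∑ i, p.2 i)} (eterm w s τ)
    refine this.trans (tsum_congr fun p => ?_)
    simp [Set.indicator_apply]
  have hs : Summable (fun p : Bool × (Fin 8 → ℤ) =>
      (if Even (∑ i, p.2 i) then eterm w s τ p else 0)) := by
    refine Summable.of_norm_bounded (summable_eterm w s hτ) fun p => ?_
    split_ifs <;> simp
  have h2 : ∀ b, ∑' z : Fin 8 → ℤ, (if Even (∑ i, z i) then eterm w s τ (b, z) else 0) =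
      1 / 2 * ((∏ i, phi (w i) s τ false b) + ∏ i, phi (w i) s τ true b) := by
    intro b
    have A := hasSum_pi_prod 8 (fun i => phiterm (w i) s τ false b)
      (fun i => summable_phiterm _ _ hτ _ _)
    have B := hasSum_pi_prod 8 (fun i => phiterm (w i) s τ true b)
      (fun i => summable_phiterm _ _ hτ _ _)
    simp_rw [eterm_ind, tsum_mul_left]
    rw [Summable.tsum_add A.1.of_norm B.1.of_norm, A.2, B.2]
    simp_rw [tsum_phiterm]
  rw [h1, hs.tsum_prod]
  simp only
  rw [tsum_fintype]
  simp only [h2, Fintype.sum_bool]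
  ring

end HeatAux

namespace HeatAux

lemma theta_fe (z : ℂ) {τ : ℂ} (hτ : 0 < τ.im) :
    jacobiTheta₂ (z / τ) (-1 / τ) = (-Complex.I * τ) ^ (1 / 2 : ℂ) *
      Complex.exp (Real.pi * Complex.I * z ^ 2 / τ) * jacobiTheta₂ z τ := by
  have h0 : τ ≠ 0 := by rintro rfl; simp at hτ
  have h1 : (-Complex.I * τ) ^ (1 / 2 : ℂ) ≠ 0 := by
    rw [Complex.cpow_ne_zero_iff]
    left
    simp [h0]
  rw [jacobiTheta₂_functional_equation z τ]
  have h2 : Complex.exp (Real.pi * Complex.I * z ^ 2 / τ) *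
      Complex.exp (-Real.pi * Complex.I * z ^ 2 / τ) = 1 := by
    rw [← Complex.exp_add, ← Complex.exp_zero]
    congr 1
    ring
  rw [show (-Complex.I * τ) ^ (1 / 2 : ℂ) * Complex.exp (Real.pi * Complex.I * z ^ 2 / τ) *
    (1 / (-Complex.I * τ) ^ (1 / 2 : ℂ) * Complex.exp (-Real.pi * Complex.I * z ^ 2 / τ) *
      jacobiTheta₂ (z / τ) (-1 / τ)) = ((-Complex.I * τ) ^ (1 / 2 : ℂ) *
      (1 / (-Complex.I * τ) ^ (1 / 2 : ℂ))) * (Complex.exp (Real.pi * Complex.I * z ^ 2 / τ) *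
      Complex.exp (-Real.pi * Complex.I * z ^ 2 / τ)) * jacobiTheta₂ (z / τ) (-1 / τ) by ring, h2,
    mul_one_div_cancel h1, one_mul, one_mul]

lemma im_neg_inv {τ : ℂ} (hτ : 0 < τ.im) : 0 < (-1 / τ).im := by
  have h0 : τ ≠ 0 := by rintro rfl; simp at hτ
  have := Complex.normSq_pos.mpr h0
  have h : (-1 / τ).im = τ.im / Complex.normSq τ := by
    simp [Complex.div_im, neg_div]
  rw [h]
  positivity

lemma phi_fe (a : ℝ) (s : ℂ) {τ : ℂ} (hτ : 0 < τ.im) (c b : Bool) :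
    phi a (s / τ) (-1 / τ) c b = (if c && b then -Complex.I else 1) *
      ((-Complex.I * τ) ^ (1 / 2 : ℂ) *
      Complex.exp (Real.pi * Complex.I * s ^ 2 / τ * (a : ℂ) ^ 2) * phi a s τ b c) := by
  have h0 : τ ≠ 0 := by rintro rfl; simp at hτ
  have key : ∀ u A B C D : ℂ, A + (Real.pi * Complex.I * u ^ 2 / τ) = D + B + C →
      Complex.exp A * ((-Complex.I * τ) ^ (1 / 2 : ℂ) *
        Complex.exp (Real.pi * Complex.I * u ^ 2 / τ) * jacobiTheta₂ u τ) =
      Complex.exp D * ((-Complex.I * τ) ^ (1 / 2 : ℂ) * Complex.exp B *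
        (Complex.exp C * jacobiTheta₂ u τ)) := by
    intro u A B C D h
    have : Complex.exp A * Complex.exp (Real.pi * Complex.I * u ^ 2 / τ) =
      Complex.exp D * Complex.exp B * Complex.exp C := by
      rw [← Complex.exp_add, ← Complex.exp_add, ← Complex.exp_add, h]
    linear_combination (-Complex.I * τ) ^ (1 / 2 : ℂ) * jacobiTheta₂ u τ * this
  have hI : Complex.exp (-(Real.pi / 2 * Complex.I)) = -Complex.I := by
    rw [Complex.exp_neg, Complex.exp_pi_div_two_mul_I, Complex.inv_I]
  cases b <;> cases c <;> simp only [phi, if_true, Bool.false_eq_true, if_false, Bool.and_true,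
    Bool.and_false, Bool.and_self]
  · have := theta_fe (s * a) hτ
    rw [show s / τ * a + 0 + 0 = s * a / τ by ring, this]
    have := key (s * a) 0 (Real.pi * Complex.I * s ^ 2 / τ * (a : ℂ) ^ 2) 0 0 (by ring)
    simpa using this
  · rw [show s / τ * a + 0 + 1 / 2 = (s * a + τ / 2) / τ by field_simp; ring, theta_fe _ hτ]
    have := key (s * a + τ / 2) 0 (Real.pi * Complex.I * s ^ 2 / τ * (a : ℂ) ^ 2)
      (Real.pi * Complex.I * τ / 4 + Real.pi * Complex.I * s * a) 0 (by field_simp; ring)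
    simp only [Complex.exp_zero, one_mul, add_zero] at this ⊢
    exact this
  · rw [show s / τ * a + -1 / τ / 2 + 0 = (s * a - 1 / 2) / τ by field_simp; ring, theta_fe _ hτ]
    have := key (s * a - 1 / 2) (Real.pi * Complex.I * (-1 / τ) / 4 +
      Real.pi * Complex.I * (s / τ) * a) (Real.pi * Complex.I * s ^ 2 / τ * (a : ℂ) ^ 2)
      0 0 (by field_simp; ring)
    rw [show s * a + 0 + 1 / 2 = (s * a - 1 / 2) + 1 by ring, jacobiTheta₂_add_left]
    simp only [Complex.exp_zero, one_mul, add_zero] at this ⊢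
    exact this
  · rw [show s / τ * a + -1 / τ / 2 + 1 / 2 = (s * a + τ / 2 - 1 / 2) / τ by field_simp; ring,
      theta_fe _ hτ]
    have := key (s * a + τ / 2 - 1 / 2) (Real.pi * Complex.I * (-1 / τ) / 4 +
      Real.pi * Complex.I * (s / τ) * a) (Real.pi * Complex.I * s ^ 2 / τ * (a : ℂ) ^ 2)
      (Real.pi * Complex.I * τ / 4 + Real.pi * Complex.I * s * a)
      (-(Real.pi / 2 * Complex.I)) (by field_simp; ring)
    rw [show s * a + τ / 2 + 1 / 2 = (s * a + τ / 2 - 1 / 2) + 1 by ring, jacobiTheta₂_add_left]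
    rw [hI] at this
    exact this

lemma F_fe (w : Fin 8 → ℝ) (s : ℂ) {τ : ℂ} (hτ : 0 < τ.im) :
    F w (s / τ) (-1 / τ) = τ ^ 4 *
      Complex.exp (Real.pi * Complex.I * s ^ 2 / τ * ((∑ i, w i ^ 2 : ℝ) : ℂ)) * F w s τ := by
  have h0 : τ ≠ 0 := by rintro rfl; simp at hτ
  have hexp : Complex.exp (Real.pi * Complex.I * s ^ 2 / τ * ((∑ i, w i ^ 2 : ℝ) : ℂ)) =
      ∏ i, Complex.exp (Real.pi * Complex.I * s ^ 2 / τ * (w i : ℂ) ^ 2) := by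
    rw [← Complex.exp_sum, ← Finset.mul_sum]
    simp
  have hp : ((-Complex.I * τ) ^ (1 / 2 : ℂ)) ^ 8 = τ ^ 4 := by
    rw [← Complex.cpow_nat_mul]
    norm_num
    rw [mul_pow, Complex.I_pow_four, one_mul]
  rw [F_eq w _ (im_neg_inv hτ), F_eq w s hτ, hexp]
  simp_rw [phi_fe _ s hτ, Finset.prod_mul_distrib, Finset.prod_const]
  simp only [Finset.card_univ, Fintype.card_fin, hp]
  have hI8 : (-Complex.I) ^ 8 = 1 := by
    rw [neg_pow, show 8 = 4 * 2 by norm_num, pow_mul Complex.I, Complex.I_pow_four]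
    norm_num
  simp only [Bool.and_true, Bool.and_false, Bool.false_eq_true, if_false, if_true, hI8, one_pow]
  ring

end HeatAux

namespace HeatAux

lemma sq_nonneg' (v : V) : 0 ≤ sq v := Finset.sum_nonneg fun i _ => sq_nonneg _

lemma norm_eterm (w : Fin 8 → ℝ) (a y : ℝ) (v : V) :
    ‖eterm w (-(a * Complex.I)) (y * Complex.I) v.1‖ =
      Real.exp (-(Real.pi * y * sq v) + 2 * Real.pi * a * ip v w) := by
  rw [eterm_eq, Complex.norm_exp]
  congr 1
  simp

lemma summable_abs (w : Fin 8 → ℝ) (A : ℝ) {y : ℝ} (hy : 0 < y) :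
    Summable (fun v : V => Real.exp (A * |ip v w|) * Real.exp (-(Real.pi * y * sq v))) := by
  have h1 := fun a => summable_V w (-((a : ℝ) * Complex.I)) (τ := (y * Complex.I)) (by simpa using hy)
  simp only [norm_eterm] at h1
  have h2 := (h1 (A / (2 * Real.pi))).add (h1 (-(A / (2 * Real.pi))))
  refine Summable.of_nonneg_of_le (fun v => by positivity) (fun v => ?_) h2
  have hpi := Real.pi_pos.ne'
  rw [← Real.exp_add]
  have e1 : 2 * Real.pi * (A / (2 * Real.pi)) * ip v w = A * ip v w := by field_simp
  have e2 : 2 * Real.pi * -(A / (2 * Real.pi)) * ip v w = -(A * ip v w) := by field_simp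
  rw [e1, e2]
  rcases abs_cases (ip v w) with ⟨h, _⟩ | ⟨h, _⟩ <;> rw [h]
  · rw [add_comm]
    linarith [Real.exp_pos (-(Real.pi * y * sq v) + -(A * ip v w))]
  · rw [add_comm, mul_neg]
    linarith [Real.exp_pos (-(Real.pi * y * sq v) + (A * ip v w))]

lemma pow_le_exp (n : ℕ) {x : ℝ} (hx : 0 ≤ x) : x ^ n ≤ n.factorial * Real.exp x := by
  have := Real.pow_div_factorial_le_exp x hx n
  rwa [div_le_iff₀' (by positivity)] at this

lemma summable_poly (w : Fin 8 → ℝ) (j k : ℕ) {y : ℝ} (hy : 0 < y) :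
    Summable (fun v : V => |ip v w| ^ j * sq v ^ k * Real.exp (-(Real.pi * y * sq v))) := by
  have h := (summable_abs w 1 (y := y / 2) (by linarith)).mul_left
    (j.factorial * (k.factorial / (Real.pi * y / 2) ^ k))
  refine Summable.of_nonneg_of_le (fun v => by have := sq_nonneg' v; positivity) (fun v => ?_) h
  have hs := sq_nonneg' v
  have hpi := Real.pi_pos
  have h1 := pow_le_exp j (abs_nonneg (ip v w))
  have h2 : sq v ^ k ≤ (k.factorial / (Real.pi * y / 2) ^ k) * Real.exp (Real.pi * y / 2 * sq v) := by
    have := pow_le_exp k (x := Real.pi * y / 2 * sq v) (by positivity)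
    rw [mul_pow] at this
    rw [div_mul_eq_mul_div, le_div_iff₀' (by positivity)]
    exact this
  have h3 : Real.exp (-(Real.pi * y * sq v)) =
    Real.exp (-(Real.pi * y / 2 * sq v)) * Real.exp (-(Real.pi * (y / 2) * sq v)) := by
    rw [← Real.exp_add]; congr 1; ring
  calc _ ≤ (j.factorial * Real.exp |ip v w|) * ((k.factorial / (Real.pi * y / 2) ^ k) *
      Real.exp (Real.pi * y / 2 * sq v)) * Real.exp (-(Real.pi * y * sq v)) := by
        gcongr
    _ = _ := by
      rw [h3, Real.exp_neg, one_mul]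
      field_simp

/-- term of the generalised theta series -/
def gterm (w : Fin 8 → ℝ) (j k : ℕ) (τ : ℂ) (v : V) : ℂ :=
  (ip v w : ℂ) ^ j * (sq v : ℂ) ^ k * Complex.exp (Real.pi * Complex.I * τ * (sq v : ℂ))

def G (w : Fin 8 → ℝ) (j k : ℕ) (τ : ℂ) : ℂ := ∑' v : V, gterm w j k τ v

lemma norm_gterm (w : Fin 8 → ℝ) (j k : ℕ) (τ : ℂ) (v : V) :
    ‖gterm w j k τ v‖ = |ip v w| ^ j * sq v ^ k * Real.exp (-(Real.pi * τ.im * sq v)) := by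
  rw [gterm, norm_mul, norm_mul, norm_pow, norm_pow, Complex.norm_real, Complex.norm_real,
    Complex.norm_exp, Real.norm_eq_abs, Real.norm_eq_abs, abs_of_nonneg (sq_nonneg' v)]
  simp

lemma summable_gterm (w : Fin 8 → ℝ) (j k : ℕ) {τ : ℂ} (hτ : 0 < τ.im) :
    Summable (fun v : V => ‖gterm w j k τ v‖) := by
  simp_rw [norm_gterm]
  exact summable_poly w j k hτ

lemma hasDerivAt_gterm (w : Fin 8 → ℝ) (j k : ℕ) (τ : ℂ) (v : V) :
    HasDerivAt (fun τ => gterm w j k τ v) (Real.pi * Complex.I * gterm w j (k + 1) τ v) τ := by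
  unfold gterm
  have h : HasDerivAt (fun τ : ℂ => Real.pi * Complex.I * τ * (sq v : ℂ))
      (Real.pi * Complex.I * 1 * (sq v : ℂ)) τ :=
    (((hasDerivAt_id τ).const_mul (Real.pi * Complex.I)).mul_const _)
  refine (h.cexp.const_mul ((ip v w : ℂ) ^ j * (sq v : ℂ) ^ k)).congr_deriv ?_
  ring

lemma hasDerivAt_G (w : Fin 8 → ℝ) (j k : ℕ) {τ : ℂ} (hτ : 0 < τ.im) :
    HasDerivAt (G w j k) (Real.pi * Complex.I * G w j (k + 1) τ) τ := by
  have hopen : IsOpen {z : ℂ | τ.im / 2 < z.im} := isOpen_lt continuous_const Complex.continuous_im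
  have hpre : IsPreconnected {z : ℂ | τ.im / 2 < z.im} :=
    (convex_halfSpace_im_gt _).isPreconnected
  have hmem : τ ∈ {z : ℂ | τ.im / 2 < z.im} := by
    show τ.im / 2 < τ.im
    linarith
  have := hasDerivAt_tsum_of_isPreconnected (g := fun v z => gterm w j k z v)
    (g' := fun v z => Real.pi * Complex.I * gterm w j (k + 1) z v)
    (u := fun v => Real.pi * (|ip v w| ^ j * sq v ^ (k + 1) * Real.exp (-(Real.pi * (τ.im / 2) * sq v))))
    ((summable_poly w j (k + 1) (y := τ.im / 2) (by linarith)).mul_left _) hopen hpre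
    (fun v z _ => hasDerivAt_gterm w j k z v) ?_ hmem (summable_gterm w j k hτ).of_norm hmem
  · rw [G, ← tsum_mul_left]
    exact this
  · intro v z hz
    have hz' : τ.im / 2 < z.im := hz
    have hs := sq_nonneg' v
    have hpi := Real.pi_pos
    rw [norm_mul, norm_mul, Complex.norm_I, mul_one, Complex.norm_real, Real.norm_eq_abs,
      abs_of_pos hpi, norm_gterm]
    gcongr

end HeatAux

namespace HeatAux

lemma coeff_unique {𝕜 : Type*} [NontriviallyNormedField 𝕜] {a b : ℕ → 𝕜} {f : 𝕜 → 𝕜}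
    (ha : ∀ᶠ s in nhds (0 : 𝕜), HasSum (fun m => a m * s ^ m) (f s))
    (hb : ∀ᶠ s in nhds (0 : 𝕜), HasSum (fun m => b m * s ^ m) (f s)) : a = b := by
  have key : ∀ c : ℕ → 𝕜, (∀ᶠ s in nhds (0 : 𝕜), HasSum (fun m => c m * s ^ m) (f s)) →
      HasFPowerSeriesAt f (FormalMultilinearSeries.ofScalars 𝕜 c) 0 := by
    intro c hc
    rw [hasFPowerSeriesAt_iff]
    filter_upwards [hc] with z hz
    simpa [FormalMultilinearSeries.coeff_ofScalars, mul_comm] using hz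
  have h := (key a ha).eq_formalMultilinearSeries (key b hb)
  funext m
  have := congrArg (fun p => p.coeff m) h
  simpa [FormalMultilinearSeries.coeff_ofScalars] using this

lemma hasSum_cexp (x : ℂ) : HasSum (fun n : ℕ => x ^ n / (n.factorial : ℂ)) (Complex.exp x) := by
  rw [Complex.exp_eq_exp_ℂ]
  exact NormedSpace.expSeries_div_hasSum_exp x

lemma hasSum_rexp (x : ℝ) : HasSum (fun n : ℕ => x ^ n / (n.factorial : ℝ)) (Real.exp x) := by
  rw [Real.exp_eq_exp_ℝ]
  exact NormedSpace.expSeries_div_hasSum_exp x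

/-- Taylor coefficients of `F` in `s`. -/
def tcoef (w : Fin 8 → ℝ) (τ : ℂ) (m : ℕ) : ℂ :=
  (2 * Real.pi * Complex.I) ^ m / (m.factorial : ℂ) * G w m 0 τ

lemma hasSum_F (w : Fin 8 → ℝ) (s : ℂ) {τ : ℂ} (hτ : 0 < τ.im) :
    HasSum (fun m => tcoef w τ m * s ^ m) (F w s τ) := by
  set f : V × ℕ → ℂ := fun p => (2 * Real.pi * Complex.I * s) ^ p.2 / (p.2.factorial : ℂ) *
    gterm w p.2 0 τ p.1 with hf
  have hfn : ∀ p, ‖f p‖ = (2 * Real.pi * ‖s‖ * |ip p.1 w|) ^ p.2 / (p.2.factorial : ℝ) *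
      Real.exp (-(Real.pi * τ.im * sq p.1)) := by
    intro p
    simp only [hf, norm_mul, norm_div, norm_pow, norm_gterm, Complex.norm_I, Complex.norm_real,
      Real.norm_eq_abs, abs_of_pos Real.pi_pos, Complex.norm_ofNat, Complex.norm_natCast]
    simp only [mul_pow]
    ring
  have hfs : Summable f := by
    apply Summable.of_norm
    rw [summable_prod_of_nonneg (fun p => norm_nonneg _)]
    have h1 : ∀ v : V, HasSum (fun m => ‖f (v, m)‖) (Real.exp (2 * Real.pi * ‖s‖ * |ip v w|) *
        Real.exp (-(Real.pi * τ.im * sq v))) := by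
      intro v
      simp only [hfn]
      exact (hasSum_rexp _).mul_right _
    refine ⟨fun v => (h1 v).summable, ?_⟩
    simp only [fun v => (h1 v).tsum_eq]
    exact summable_abs w _ hτ
  have h2 : ∀ v : V, HasSum (fun m => f (v, m)) (eterm w s τ v.1) := by
    intro v
    rw [eterm_eq, add_comm, Complex.exp_add]
    refine ((hasSum_cexp _).mul_right _).congr_fun ?_
    intro m
    simp only [hf, gterm, mul_pow]
    ring
  have h3 : HasSum f (F w s τ) := by
    have := hfs.hasSum.prod_fiberwise h2
    rw [F, this.tsum_eq]
    exact hfs.hasSum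
  have h4 : HasSum (f ∘ Prod.swap) (F w s τ) := (Equiv.prodComm ℕ V).hasSum_iff.mpr h3
  refine h4.prod_fiberwise ?_
  intro m
  have h5 := (((summable_gterm w m 0 hτ).of_norm).hasSum).mul_left
    ((2 * Real.pi * Complex.I * s) ^ m / (m.factorial : ℂ))
  have h6 : tcoef w τ m * s ^ m = (2 * Real.pi * Complex.I * s) ^ m / (m.factorial : ℂ) *
      ∑' v : V, gterm w m 0 τ v := by
    rw [tcoef, G, mul_pow _ s]
    ring
  simp only [h6]
  exact h5

def ecoef (α : ℂ) (m : ℕ) : ℂ := if Even m then α ^ (m / 2) / ((m / 2).factorial : ℂ) else 0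

lemma hasSum_ecoef (α s : ℂ) : HasSum (fun m => ecoef α m * s ^ m) (Complex.exp (α * s ^ 2)) := by
  have hi : Function.Injective (fun n : ℕ => 2 * n) := fun a b h => by simpa using h
  rw [← hi.hasSum_iff]
  · refine (hasSum_cexp (α * s ^ 2)).congr_fun ?_
    intro n
    simp [ecoef, mul_pow, ← pow_mul]
    ring
  · intro m hm
    have : ¬ Even m := by
      rintro ⟨r, hr⟩
      exact hm ⟨r, by simp only; omega⟩
    simp [ecoef, this]

lemma tcoef_fe (w : Fin 8 → ℝ) {τ : ℂ} (hτ : 0 < τ.im) (m : ℕ) :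
    tcoef w (-1 / τ) m = τ ^ (4 + m) * ∑ p ∈ Finset.HasAntidiagonal.antidiagonal m,
      ecoef (Real.pi * Complex.I * ((∑ i, w i ^ 2 : ℝ) : ℂ) / τ) p.1 * tcoef w τ p.2 := by
  have h0 : τ ≠ 0 := by rintro rfl; simp at hτ
  set α := Real.pi * Complex.I * ((∑ i, w i ^ 2 : ℝ) : ℂ) / τ with hα
  have h1 : ∀ s : ℂ, HasSum (fun m => tcoef w (-1 / τ) m / τ ^ m * s ^ m) (F w (s / τ) (-1 / τ)) := by
    intro s
    refine (hasSum_F w (s / τ) (im_neg_inv hτ)).congr_fun ?_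
    intro m
    rw [div_pow]
    ring
  have h2 : ∀ s : ℂ, HasSum (fun m => (τ ^ 4 * ∑ p ∈ Finset.HasAntidiagonal.antidiagonal m,
      ecoef α p.1 * tcoef w τ p.2) * s ^ m) (F w (s / τ) (-1 / τ)) := by
    intro s
    have hA := hasSum_ecoef α s
    have hB := hasSum_F w s hτ
    have hC := (summable_norm_sum_mul_antidiagonal_of_summable_norm hA.summable.norm
      hB.summable.norm).of_norm.hasSum
    rw [← tsum_mul_tsum_eq_tsum_sum_antidiagonal_of_summable_norm hA.summable.norm
      hB.summable.norm, hA.tsum_eq, hB.tsum_eq] at hC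
    have hD := hC.mul_left (τ ^ 4)
    rw [F_fe w s hτ, mul_assoc, show Real.pi * Complex.I * s ^ 2 / τ * ((∑ i, w i ^ 2 : ℝ) : ℂ) =
      α * s ^ 2 by rw [hα]; ring]
    refine hD.congr_fun ?_
    intro m
    rw [mul_assoc, Finset.sum_mul]
    congr 1
    refine Finset.sum_congr rfl fun p hp => ?_
    rw [← Finset.HasAntidiagonal.mem_antidiagonal.mp hp, pow_add]
    ring
  have := congrFun (coeff_unique (Filter.Eventually.of_forall h1) (Filter.Eventually.of_forall h2)) m
  rw [div_eq_iff (pow_ne_zero _ h0)] at this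
  rw [this, pow_add]
  ring

end HeatAux

namespace HeatAux

/-- iterates of `τ² d/dτ` on `τ^e G_{i,m}` -/
def T (w : Fin 8 → ℝ) (i : ℕ) : ℕ → ℕ → ℕ → ℂ → ℂ
  | e, m, 0, τ => τ ^ e * G w i m τ
  | e, m, k + 1, τ => e * T w i (e + 1) m k τ +
      Real.pi * Complex.I * T w i (e + 2) (m + 1) k τ

lemma hasDerivAt_T (w : Fin 8 → ℝ) (i : ℕ) {τ : ℂ} (hτ : 0 < τ.im) (k : ℕ) : ∀ (e m : ℕ),
    HasDerivAt (T w i e m k) (T w i e m (k + 1) τ / τ ^ 2) τ := by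
  have h0 : τ ≠ 0 := by rintro rfl; simp at hτ
  induction k with
  | zero =>
    intro e m
    have h := (hasDerivAt_pow e τ).mul (hasDerivAt_G w i m hτ)
    have h' : T w i e m 0 = fun τ => τ ^ e * G w i m τ := by funext τ; rw [T]
    rw [h']
    refine h.congr_deriv ?_
    simp only [T]
    rcases e with _ | e
    · field_simp
      simp
    · field_simp
      simp
      ring
  | succ k ih =>
    intro e m
    have h := ((ih (e + 1) m).const_mul (e : ℂ)).add
      ((ih (e + 2) (m + 1)).const_mul (Real.pi * Complex.I))
    have h' : T w i e m (k + 1) = fun τ => e * T w i (e + 1) m k τ +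
      Real.pi * Complex.I * T w i (e + 2) (m + 1) k τ := by funext τ; rw [T]
    rw [h', T]
    refine h.congr_deriv ?_
    ring

lemma G_fe (w : Fin 8 → ℝ) (m k : ℕ) : ∀ {τ : ℂ}, 0 < τ.im →
    (2 * Real.pi * Complex.I) ^ m / (m.factorial : ℂ) * (Real.pi * Complex.I) ^ k *
      G w m k (-1 / τ) = ∑ q ∈ Finset.HasAntidiagonal.antidiagonal m,
      (ecoef (Real.pi * Complex.I * ((∑ i, w i ^ 2 : ℝ) : ℂ)) q.1 *
        ((2 * Real.pi * Complex.I) ^ q.2 / (q.2.factorial : ℂ))) *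
      T w q.2 (4 + m - q.1 / 2) 0 k τ := by
  induction k with
  | zero =>
    intro τ hτ
    have h0 : τ ≠ 0 := by rintro rfl; simp at hτ
    have := tcoef_fe w hτ m
    rw [tcoef] at this
    rw [pow_zero, mul_one, this, Finset.mul_sum]
    refine Finset.sum_congr rfl fun q hq => ?_
    have hq' := Finset.HasAntidiagonal.mem_antidiagonal.mp hq
    rw [tcoef, T]
    have h1 : τ ^ (4 + m) = τ ^ (4 + m - q.1 / 2) * τ ^ (q.1 / 2) := by
      rw [← pow_add]; congr 1; omega
    have h2 : ecoef (Real.pi * Complex.I * ((∑ i, w i ^ 2 : ℝ) : ℂ) / τ) q.1 * τ ^ (q.1 / 2) =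
        ecoef (Real.pi * Complex.I * ((∑ i, w i ^ 2 : ℝ) : ℂ)) q.1 := by
      unfold ecoef
      split_ifs
      · rw [div_pow]
        field_simp
      · simp
    rw [h1, ← h2]
    ring
  | succ k ih =>
    intro τ hτ
    have h0 : τ ≠ 0 := by rintro rfl; simp at hτ
    have hR := HasDerivAt.fun_sum (u := Finset.HasAntidiagonal.antidiagonal m) (fun q _ =>
      (hasDerivAt_T w q.2 hτ k (4 + m - q.1 / 2) 0).const_mul
      (ecoef (Real.pi * Complex.I * ((∑ i, w i ^ 2 : ℝ) : ℂ)) q.1 *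
        ((2 * Real.pi * Complex.I) ^ q.2 / (q.2.factorial : ℂ))))
    have hinv : HasDerivAt (fun z : ℂ => -1 / z) (1 / τ ^ 2) τ := by
      have := (hasDerivAt_inv h0).const_mul (-1)
      refine (this.congr_deriv ?_)
      ring
    have hL := ((hasDerivAt_G w m k (im_neg_inv hτ)).comp τ hinv).const_mul
      ((2 * Real.pi * Complex.I) ^ m / (m.factorial : ℂ) * (Real.pi * Complex.I) ^ k)
    have hev : (fun z => (2 * Real.pi * Complex.I) ^ m / (m.factorial : ℂ) *
        (Real.pi * Complex.I) ^ k * (G w m k ∘ fun z : ℂ => -1 / z) z) =ᶠ[nhds τ]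
        (fun z => ∑ q ∈ Finset.HasAntidiagonal.antidiagonal m,
      (ecoef (Real.pi * Complex.I * ((∑ i, w i ^ 2 : ℝ) : ℂ)) q.1 *
        ((2 * Real.pi * Complex.I) ^ q.2 / (q.2.factorial : ℂ))) *
      T w q.2 (4 + m - q.1 / 2) 0 k z) := by
      have hopen : IsOpen {z : ℂ | 0 < z.im} := isOpen_lt continuous_const Complex.continuous_im
      filter_upwards [hopen.mem_nhds hτ] with z hz
      exact ih hz
    have := (hL.congr_of_eventuallyEq hev.symm).unique hR
    have h3 : (2 * Real.pi * Complex.I) ^ m / (m.factorial : ℂ) * (Real.pi * Complex.I) ^ (k + 1) *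
      G w m (k + 1) (-1 / τ) = τ ^ 2 * ((2 * Real.pi * Complex.I) ^ m / (m.factorial : ℂ) *
        (Real.pi * Complex.I) ^ k * (Real.pi * Complex.I * G w m (k + 1) (-1 / τ) * (1 / τ ^ 2))) := by
      field_simp
      ring
    rw [h3, this, Finset.mul_sum]
    refine Finset.sum_congr rfl fun q _ => ?_
    field_simp

/-- The theta series with harmonic coefficients -/
def H (w : Fin 8 → ℝ) (τ : ℂ) : ℂ :=
  1 / 40320 * G w 8 0 τ - 1 / 28800 * ((∑ i, w i ^ 2 : ℝ) : ℂ) * G w 6 1 τ +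
  1 / 69120 * ((∑ i, w i ^ 2 : ℝ) : ℂ) ^ 2 * G w 4 2 τ -
  1 / 552960 * ((∑ i, w i ^ 2 : ℝ) : ℂ) ^ 3 * G w 2 3 τ +
  1 / 30965760 * ((∑ i, w i ^ 2 : ℝ) : ℂ) ^ 4 * G w 0 4 τ

lemma H_fe (w : Fin 8 → ℝ) {τ : ℂ} (hτ : 0 < τ.im) : H w (-1 / τ) = τ ^ 12 * H w τ := by
  have r0 := G_fe w 8 0 hτ
  have r1 := G_fe w 6 1 hτ
  have r2 := G_fe w 4 2 hτ
  have r3 := G_fe w 2 3 hτ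
  have r4 := G_fe w 0 4 hτ
  have hp : (Real.pi * Complex.I : ℂ) ^ 8 ≠ 0 := by
    apply pow_ne_zero
    simp [Real.pi_ne_zero]
  apply mul_left_cancel₀ hp
  unfold H
  simp only [Finset.Nat.antidiagonal_succ, Finset.Nat.antidiagonal_zero, Finset.sum_cons,
    Finset.map_cons, Finset.map_singleton, Finset.sum_singleton, ecoef, T] at r0 r1 r2 r3 r4
  rw [show 2 * (Real.pi : ℂ) * Complex.I = 2 * (Real.pi * Complex.I) by ring] at r0 r1 r2 r3 r4
  generalize (Real.pi * Complex.I : ℂ) = p at *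
  generalize ((∑ i, w i ^ 2 : ℝ) : ℂ) = N at *
  norm_num [Nat.factorial, Nat.even_iff] at r0 r1 r2 r3 r4
  linear_combination 1 / 256 * r0 - 720 / 28800 / 64 * N * p * r1 +
    24 / 69120 / 16 * N ^ 2 * p ^ 2 * r2 - 2 / 552960 / 4 * N ^ 3 * p ^ 3 * r3 +
    1 / 30965760 * N ^ 4 * p ^ 4 * r4

end HeatAux

namespace HeatAux

lemma even_nrm (v : V) : (2 : ℤ) ∣ (∑ i, v.1.2 i ^ 2 + if v.1.1 then (∑ i, v.1.2 i) + 2 else 0) := by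
  obtain ⟨⟨b, z⟩, hz⟩ := v
  have h1 : (2 : ℤ) ∣ ∑ i, z i ^ 2 - ∑ i, z i := by
    rw [← Finset.sum_sub_distrib]
    refine Finset.dvd_sum fun i _ => ?_
    rw [show z i ^ 2 - z i = (z i - 1) * (z i - 1 + 1) by ring]
    exact (Int.even_mul_succ_self _).two_dvd
  have h2 : (2 : ℤ) ∣ ∑ i, z i := (show Even (∑ i, z i) from hz).two_dvd
  cases b <;> simp <;> omega

/-- half the squared norm -/
def nrm (v : V) : ℕ :=
  ((∑ i, v.1.2 i ^ 2 + if v.1.1 then (∑ i, v.1.2 i) + 2 else 0) / 2).toNat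

lemma sq_eq_int (v : V) :
    sq v = ((∑ i, v.1.2 i ^ 2 + if v.1.1 then (∑ i, v.1.2 i) + 2 else 0 : ℤ) : ℝ) := by
  obtain ⟨⟨b, z⟩, hz⟩ := v
  cases b
  · simp [sq, co, co']
  · simp [sq, co, co', add_sq, Finset.sum_add_distrib]
    rw [← Finset.sum_mul, ← Finset.mul_sum]
    ring

lemma sq_eq (v : V) : sq v = 2 * (nrm v : ℝ) := by
  obtain ⟨m, hm⟩ := even_nrm v
  have h := sq_eq_int v
  rw [hm] at h
  have h0 := sq_nonneg' v
  have hm0 : 0 ≤ m := by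
    rw [h] at h0
    have : (0 : ℤ) ≤ 2 * m := by exact_mod_cast h0
    omega
  rw [h, nrm, hm, Int.mul_ediv_cancel_left _ (by norm_num)]
  push_cast
  congr 1
  exact_mod_cast (Int.toNat_of_nonneg hm0).symm

/-- the zonal harmonic -/
def zz (v : V) (w : Fin 8 → ℝ) : ℝ :=
  1 / 40320 * ip v w ^ 8 - 1 / 28800 * (∑ i, w i ^ 2) * (ip v w ^ 6 * sq v) +
  1 / 69120 * (∑ i, w i ^ 2) ^ 2 * (ip v w ^ 4 * sq v ^ 2) -
  1 / 552960 * (∑ i, w i ^ 2) ^ 3 * (ip v w ^ 2 * sq v ^ 3) +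
  1 / 30965760 * (∑ i, w i ^ 2) ^ 4 * sq v ^ 4

lemma hasSum_H (w : Fin 8 → ℝ) {τ : ℂ} (hτ : 0 < τ.im) :
    HasSum (fun v : V => (zz v w : ℂ) * Complex.exp (2 * Real.pi * Complex.I * τ) ^ nrm v)
      (H w τ) := by
  have hs := fun j k => (summable_gterm w j k hτ).of_norm.hasSum
  have h := ((((hs 8 0).mul_left (1 / 40320)).sub
    ((hs 6 1).mul_left (1 / 28800 * ((∑ i, w i ^ 2 : ℝ) : ℂ)))).add
    ((hs 4 2).mul_left (1 / 69120 * ((∑ i, w i ^ 2 : ℝ) : ℂ) ^ 2))).sub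
    ((hs 2 3).mul_left (1 / 552960 * ((∑ i, w i ^ 2 : ℝ) : ℂ) ^ 3)) |>.add
    ((hs 0 4).mul_left (1 / 30965760 * ((∑ i, w i ^ 2 : ℝ) : ℂ) ^ 4))
  refine h.congr_fun ?_
  intro v
  have he : Complex.exp (2 * Real.pi * Complex.I * τ) ^ nrm v =
      Complex.exp (Real.pi * Complex.I * τ * (sq v : ℂ)) := by
    rw [← Complex.exp_nat_mul, sq_eq]
    congr 1
    push_cast
    ring
  rw [he]
  simp only [gterm, zz]
  push_cast
  ring

/-- shell sums -/
def Sh (w : Fin 8 → ℝ) (n : ℕ) : ℝ := ∑' v : nrm ⁻¹' {n}, zz v.1 w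

lemma hasSum_Sh (w : Fin 8 → ℝ) {τ : ℂ} (hτ : 0 < τ.im) :
    HasSum (fun n => (Sh w n : ℂ) * Complex.exp (2 * Real.pi * Complex.I * τ) ^ n) (H w τ) := by
  refine ((hasSum_H w hτ).tsum_fiberwise nrm).congr_fun ?_
  intro n
  rw [Sh, Complex.ofReal_tsum, ← tsum_mul_right]
  refine tsum_congr ?_
  rintro ⟨v, hv⟩
  have hv' : nrm v = n := hv
  simp only [hv']

lemma zz_eq_zero (v : V) (w : Fin 8 → ℝ) (h : nrm v = 0) : zz v w = 0 := by
  have h1 : sq v = 0 := by rw [sq_eq, h]; simp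
  have h2 : ∀ i, co v i = 0 := by
    intro i
    have := (Finset.sum_eq_zero_iff_of_nonneg (fun i _ => sq_nonneg (co v i))).mp h1 i
      (Finset.mem_univ i)
    exact pow_eq_zero_iff (by norm_num) |>.mp this
  have h3 : ip v w = 0 := by simp [ip, h2]
  simp [zz, h1, h3]

lemma Sh_zero (w : Fin 8 → ℝ) : Sh w 0 = 0 := by
  rw [Sh]
  have : ∀ v : nrm ⁻¹' {0}, zz v.1 w = 0 := fun v => zz_eq_zero _ _ v.2
  simp [this]

open UpperHalfPlane ModularForm MatrixGroups Function in
def Hh (w : Fin 8 → ℝ) (z : UpperHalfPlane) : ℂ := H w z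

open UpperHalfPlane ModularForm MatrixGroups Function

lemma hasSum_Hh (w : Fin 8 → ℝ) (z : UpperHalfPlane) :
    HasSum (fun n => (Sh w n : ℂ) • (Periodic.qParam 1 z) ^ n) (Hh w z) := by
  have := hasSum_Sh w z.im_pos
  rw [Hh]
  simpa [Periodic.qParam] using this

lemma Hh_S (w : Fin 8 → ℝ) : (Hh w ∣[(12 : ℤ)] ModularGroup.S) = Hh w := by
  ext z
  have h := H_fe w z.im_pos
  have h0 := z.ne_zero
  rw [SL_slash_apply, UpperHalfPlane.modular_S_smul, ModularGroup.denom_S, Hh, Hh,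
    UpperHalfPlane.coe_mk, show (-(z : ℂ))⁻¹ = -1 / (z : ℂ) by rw [inv_neg, neg_div, one_div], h,
    zpow_neg, mul_comm, ← mul_assoc]
  rw [show (z : ℂ) ^ (12 : ℤ) = (z : ℂ) ^ 12 from zpow_natCast (z : ℂ) 12, inv_mul_cancel₀ (pow_ne_zero _ h0), one_mul]

lemma Hh_T (w : Fin 8 → ℝ) : (Hh w ∣[(12 : ℤ)] ModularGroup.T) = Hh w := by
  ext z
  have hd : denom ModularGroup.T z = 1 := by
    rw [ModularGroup.denom_apply]
    simp [ModularGroup.T]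
  rw [SL_slash_apply, hd, modular_T_smul, one_zpow, mul_one]
  have h1 := hasSum_Sh w z.im_pos
  have h2 := hasSum_Sh w (τ := 1 + z) (by simpa using z.im_pos)
  have he : Complex.exp (2 * Real.pi * Complex.I * (1 + z)) =
      Complex.exp (2 * Real.pi * Complex.I * z) := by
    rw [← Complex.exp_periodic (2 * Real.pi * Complex.I * z)]
    ring_nf
  rw [he] at h2
  simpa [Hh] using h2.unique h1

lemma Hh_zero (w : Fin 8 → ℝ) : IsZeroAtImInfty (Hh w) := by
  have hb : IsBoundedAtImInfty (fun z : UpperHalfPlane => Hh w z / Periodic.qParam 1 z) := by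
    apply isBoundedAtImInfty_of_hasSum_qExpansion (h := 1) one_pos (c := fun n => (Sh w (n + 1) : ℂ))
    intro z
    have h0 : Periodic.qParam 1 z ≠ 0 := Periodic.qParam_ne_zero _
    have h := (hasSum_nat_add_iff' 1).mpr (hasSum_Hh w z)
    simp only [Finset.sum_range_one, Sh_zero, Complex.ofReal_zero, zero_smul, sub_zero] at h
    refine (h.div_const (Periodic.qParam 1 z)).congr_fun ?_
    intro n
    simp only [smul_eq_mul, pow_succ]
    field_simp
  have hq : Filter.ZeroAtFilter atImInfty (fun z : UpperHalfPlane => Periodic.qParam 1 z) :=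
    qParam_tendsto_atImInfty one_pos
  have := hq.mul_boundedAtFilter hb
  have he : Hh w = (fun z : UpperHalfPlane => Periodic.qParam 1 z) *
      (fun z : UpperHalfPlane => Hh w z / Periodic.qParam 1 z) := by
    funext z
    have h0 : Periodic.qParam 1 z ≠ 0 := Periodic.qParam_ne_zero _
    simp only [Pi.mul_apply]
    field_simp
  rw [he]
  exact this

lemma differentiableAt_H (w : Fin 8 → ℝ) {τ : ℂ} (hτ : 0 < τ.im) : DifferentiableAt ℂ (H w) τ := by
  have h := fun j k => (hasDerivAt_G w j k hτ).differentiableAt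
  unfold H
  exact (((((h 8 0).const_mul _).sub ((h 6 1).const_mul _)).add ((h 4 2).const_mul _)).sub
    ((h 2 3).const_mul _)).add ((h 0 4).const_mul _)

def Hcusp (w : Fin 8 → ℝ) : CuspForm 𝒮ℒ 12 where
  toFun := Hh w
  slash_action_eq' A hA := by
    obtain ⟨A, rfl⟩ := hA
    exact SlashInvariantForm.slash_action_generators_SL2Z (Hh_S w) (Hh_T w) A
  holo' := by
    rw [UpperHalfPlane.mdifferentiable_iff]
    refine DifferentiableOn.congr (fun z hz ↦ (differentiableAt_H w hz).differentiableWithinAt)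
      fun z hz ↦ ?_
    simp [Hh, ofComplex_apply_of_im_pos hz]
  zero_at_cusps' hc := by
    rw [Subgroup.IsArithmetic.isCusp_iff_isCusp_SL2Z] at hc
    rw [OnePoint.isZeroAt_iff_forall_SL2Z hc]
    intro γ _
    rw [SlashInvariantForm.slash_action_generators_SL2Z (Hh_S w) (Hh_T w)]
    exact Hh_zero w

def tau (n : ℕ) : ℂ := (qExpansion 1 ModularForm.discriminant).coeff n

lemma Sh_eq (w : Fin 8 → ℝ) (n : ℕ) : (Sh w n : ℂ) = tau n * Sh w 1 := by
  obtain ⟨c, hc⟩ := CuspForm.exists_smul_discriminant_of_weight_eq_twelve (Hcusp w)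
  have h1 : ∀ n, (Sh w n : ℂ) = (qExpansion 1 (Hcusp w)).coeff n := fun n =>
    ModularFormClass.qExpansion_coeff_unique (Γ := 𝒮ℒ) (k := 12) one_pos one_mem_strictPeriods_SL
      (f := Hcusp w) (fun z => hasSum_Hh w z) n
  have h2 := ModularForm.qExpansion_smul one_pos one_mem_strictPeriods_SL c CuspForm.discriminant
  have h3 : (c • CuspForm.discriminant : UpperHalfPlane → ℂ) = Hcusp w := congrArg DFunLike.coe hc
  rw [h3] at h2
  have h4 : ∀ n, (Sh w n : ℂ) = c * tau n := by
    intro n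
    rw [h1, h2]
    simp [tau]
  have h5 := h4 1
  rw [tau, discriminant_qExpansion_coeff_one, mul_one] at h5
  rw [h4, h5]
  ring

end HeatAux

namespace HeatAux

/-- integer vectors with entries in `C` and given sum of squares -/
def genF (C : List ℤ) : (n : ℕ) → ℕ → List (Fin n → ℤ)
  | 0, b => if b = 0 then [Fin.elim0] else []
  | n + 1, b => C.flatMap (fun a => if a.natAbs ^ 2 ≤ b then
      (genF C n (b - a.natAbs ^ 2)).map (fun f => (Fin.cons a f : Fin (n + 1) → ℤ)) else [])

def genL (C : List ℤ) : (n : ℕ) → ℕ → List (List ℤ)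
  | 0, b => if b = 0 then [[]] else []
  | n + 1, b => C.flatMap (fun a => if a.natAbs ^ 2 ≤ b then
      (genL C n (b - a.natAbs ^ 2)).map (fun f => a :: f) else [])

lemma genL_eq (C : List ℤ) (n : ℕ) : ∀ b, genL C n b = (genF C n b).map List.ofFn := by
  induction n with
  | zero => intro b; simp only [genL, genF]; split_ifs <;> simp
  | succ n ih =>
    intro b
    simp only [genL, genF, List.map_flatMap]
    congr 1
    funext a
    split_ifs
    · rw [ih, List.map_map, List.map_map]
      congr 1
      funext f
      simp [List.ofFn_succ]
    · simp

lemma mem_genF (C : List ℤ) (n : ℕ) : ∀ (b : ℕ) (y : Fin n → ℤ),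
    y ∈ genF C n b ↔ (∀ i, y i ∈ C) ∧ ∑ i, (y i).natAbs ^ 2 = b := by
  induction n with
  | zero =>
    intro b y
    simp only [genF]
    have : y = Fin.elim0 := Subsingleton.elim _ _
    split_ifs with h
    · simp [h, this]
    · simp [Ne.symm h]
  | succ n ih =>
    intro b y
    simp only [genF, List.mem_flatMap, Fin.sum_univ_succ, Fin.forall_fin_succ]
    constructor
    · rintro ⟨a, ha, h⟩
      split_ifs at h with hb
      · obtain ⟨f, hf, rfl⟩ := List.mem_map.mp h
        obtain ⟨h1, h2⟩ := (ih _ _).mp hf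
        simp only [Fin.cons_zero, Fin.cons_succ]
        exact ⟨⟨ha, h1⟩, by omega⟩
      · simp at h
    · rintro ⟨⟨h0, h1⟩, h2⟩
      refine ⟨y 0, h0, ?_⟩
      rw [if_pos (by omega), List.mem_map]
      refine ⟨Fin.tail y, (ih _ _).mpr ⟨h1, ?_⟩, Fin.cons_self_tail y⟩
      simp only [Fin.tail]
      omega

lemma nodup_genF (C : List ℤ) (hC : C.Nodup) (n : ℕ) : ∀ (b : ℕ), (genF C n b).Nodup := by
  induction n with
  | zero => intro b; simp only [genF]; split_ifs <;> simp
  | succ n ih =>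
    intro b
    simp only [genF]
    rw [List.nodup_flatMap]
    constructor
    · intro a _
      split_ifs
      · exact (ih _).map (Fin.cons_right_injective (α := fun _ => ℤ) a)
      · simp
    · refine hC.imp ?_
      intro a c hac
      simp only [Function.onFun]
      intro y h1 h2
      split_ifs at h1 h2 <;> try simp at h1 h2
      obtain ⟨f, _, rfl⟩ := h1
      obtain ⟨g, _, hg⟩ := h2
      exact hac (by simpa using (congrFun hg 0).symm)

def evenL (l : List ℤ) : Bool := l.sum % 4 == 0

/-- the list of (doubled) roots -/
def LY : List (Fin 8 → ℤ) := genF [-2, 0, 2] 8 8 ++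
  (genF [-1, 1] 8 8).filter (fun y => evenL (List.ofFn y))

def LL : List (List ℤ) := genL [-2, 0, 2] 8 8 ++ (genL [-1, 1] 8 8).filter evenL

lemma LL_eq : LL = LY.map List.ofFn := by
  rw [LL, LY, genL_eq, genL_eq, List.map_append, List.filter_map]
  rfl

lemma nodup_LY : LY.Nodup := by
  rw [LY, List.nodup_append]
  refine ⟨nodup_genF _ (by decide) _ _, (nodup_genF _ (by decide) _ _).filter _, ?_⟩
  rintro a ha b hb rfl
  have h1 := ((mem_genF _ _ _ _).mp ha).1 0
  have h2 := ((mem_genF _ _ _ _).mp (List.mem_filter.mp hb).1).1 0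
  simp at h1 h2
  omega

def dot : List ℤ → List ℤ → ℤ
  | a :: l, b :: m => a * b + dot l m
  | _, _ => 0

lemma dot_ofFn (n : ℕ) : ∀ (x y : Fin n → ℤ), dot (List.ofFn x) (List.ofFn y) = ∑ i, x i * y i := by
  induction n with
  | zero => intro x y; simp [dot]
  | succ n ih => intro x y; simp [dot, List.ofFn_succ, ih, Fin.sum_univ_succ]

def hor (d : ℤ) : ℤ := let e := d * d
  (((15 * e - 1344) * e + 35840) * e - 286720) * e + 327680

/-- an evaluation-friendly form of `hor` -/
def horN : ℕ → ℤ
  | 0 => 327680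
  | n + 1 => hor (n + 1)

def horZ (d : ℤ) : ℤ := Int.casesOn (motive := fun _ => ℤ) d (fun n => horN n) (fun n => horN (n + 1))

lemma horN_eq (n : ℕ) : horN n = hor n := by
  cases n with
  | zero => simp [horN, hor]
  | succ n => simp [horN]

lemma horZ_eq (d : ℤ) : horZ d = hor d := by
  cases d with
  | ofNat n => exact horN_eq n
  | negSucc n =>
    refine (horN_eq (n + 1)).trans ?_
    simp only [hor, Int.negSucc_eq]
    push_cast
    ring

lemma hor_neg (d : ℤ) : hor (-d) = hor d := by simp only [hor]; ring

def posL : List ℤ → Bool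
  | [] => false
  | a :: l => if a = 0 then posL l else decide (0 < a)

def LH : List (List ℤ) := LL.filter posL

def negL (l : List ℤ) : List ℤ := l.map (fun a => -a)

lemma dot_negL_left : ∀ l m : List ℤ, dot (negL l) m = - dot l m
  | [], m => by simp [negL, dot]
  | a :: l, [] => by simp [negL, dot]
  | a :: l, b :: m => by
    have := dot_negL_left l m
    simp only [negL, List.map_cons, dot] at this ⊢
    rw [this]
    ring

lemma dot_negL_right : ∀ l m : List ℤ, dot l (negL m) = - dot l m
  | [], m => by simp [dot]
  | a :: l, [] => by simp [negL, dot]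
  | a :: l, b :: m => by
    have := dot_negL_right l m
    simp only [negL, List.map_cons, dot] at this ⊢
    rw [this]
    ring

lemma LL_perm : LL.Perm (LH ++ LH.map negL) := by
  rw [← List.isPerm_iff]
  decide +kernel

lemma compute_half : (LH.map (fun l => (LH.map (fun m => horZ (dot l m))).sum)).sum = 8493465600 := by
  decide +kernel

lemma compute : (LL.map (fun l => (LL.map (fun m => hor (dot l m))).sum)).sum = 33973862400 := by
  have h := compute_half
  simp only [horZ_eq] at h
  have h1 : ∀ f : List ℤ → ℤ, (∀ l, f (negL l) = f l) →
      (LL.map f).sum = 2 * (LH.map f).sum := by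
    intro f hf
    rw [(LL_perm.map f).sum_eq, List.map_append, List.sum_append, List.map_map]
    have : f ∘ negL = f := funext hf
    rw [this]
    ring
  rw [h1]
  · have h2 : ∀ l, (LL.map (fun m => hor (dot l m))).sum
        = 2 * (LH.map (fun m => hor (dot l m))).sum := by
      intro l
      refine h1 _ fun m => ?_
      rw [dot_negL_right, hor_neg]
    simp only [h2]
    rw [List.sum_map_mul_left, h]
    norm_num
  · intro l
    simp only [dot_negL_left, hor_neg]

/-- doubled coordinates -/
def yv (v : V) (i : Fin 8) : ℤ := 2 * v.1.2 i + if v.1.1 then 1 else 0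

lemma co_eq (v : V) (i : Fin 8) : co v i = (yv v i : ℝ) / 2 := by
  obtain ⟨⟨b, z⟩, hz⟩ := v
  cases b
  · simp [co, co', yv]
  · simp [co, co', yv]
    ring

lemma yv_inj : Function.Injective yv := by
  rintro ⟨⟨b, z⟩, hz⟩ ⟨⟨b', z'⟩, hz'⟩ h
  have h' : ∀ i, 2 * z i + (if b then 1 else 0) = 2 * z' i + (if b' then 1 else 0) :=
    fun i => congrFun h i
  have hb : b = b' := by
    have := h' 0
    cases b <;> cases b' <;> simp at this ⊢ <;> omega
  subst hb
  have hz : z = z' := by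
    funext i
    have := h' i
    omega
  subst hz
  rfl

lemma sum_yv (v : V) : ∑ i, yv v i ^ 2 = 8 * (nrm v : ℤ) := by
  have h := sq_eq v
  have : sq v = ((∑ i, yv v i ^ 2 : ℤ) : ℝ) / 4 := by
    rw [sq]
    simp only [co_eq]
    push_cast
    rw [Finset.sum_div]
    refine Finset.sum_congr rfl fun i _ => ?_
    ring
  rw [this] at h
  have h2 : ((∑ i, yv v i ^ 2 : ℤ) : ℝ) = ((8 * (nrm v : ℤ) : ℤ) : ℝ) := by
    push_cast at h ⊢
    linarith
  exact_mod_cast h2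

lemma natAbs_sum (y : Fin 8 → ℤ) (n : ℕ) : ∑ i, (y i).natAbs ^ 2 = n ↔ ∑ i, y i ^ 2 = (n : ℤ) := by
  rw [← Nat.cast_inj (R := ℤ)]
  push_cast
  simp

lemma evenL_iff (y : Fin 8 → ℤ) : evenL (List.ofFn y) = true ↔ (4 : ℤ) ∣ ∑ i, y i := by
  rw [evenL, List.sum_ofFn]
  simp only [beq_iff_eq]
  omega

lemma yv_mem (v : V) (hv : nrm v = 1) : yv v ∈ LY := by
  have h8 := sum_yv v
  rw [hv] at h8
  have hle : ∀ i, yv v i ^ 2 ≤ 8 := by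
    intro i
    calc _ ≤ ∑ i, yv v i ^ 2 := Finset.single_le_sum (f := fun i => yv v i ^ 2)
          (fun i _ => sq_nonneg _) (Finset.mem_univ i)
      _ = 8 := by rw [h8]; norm_num
  have hb : ∀ i, -2 ≤ yv v i ∧ yv v i ≤ 2 := by
    intro i
    have := hle i
    constructor <;> nlinarith
  have hs := (natAbs_sum (yv v) 8).mpr (by rw [h8]; norm_num)
  obtain ⟨⟨b, z⟩, hz⟩ := v
  rw [LY, List.mem_append, List.mem_filter, mem_genF, mem_genF]
  cases b
  · left
    refine ⟨fun i => ?_, hs⟩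
    have := hb i
    simp [yv] at this ⊢
    omega
  · right
    refine ⟨⟨fun i => ?_, hs⟩, ?_⟩
    · have := hb i
      simp [yv] at this ⊢
      omega
    · rw [evenL_iff]
      simp only [yv, if_true, Finset.sum_add_distrib, ← Finset.mul_sum]
      obtain ⟨r, hr⟩ : Even (∑ i, z i) := hz
      rw [hr]
      simp
      omega

lemma mem_yv (y : Fin 8 → ℤ) (hy : y ∈ LY) : ∃ v : V, nrm v = 1 ∧ yv v = y := by
  have key : ∀ v : V, yv v = y → ∑ i, (y i).natAbs ^ 2 = 8 → nrm v = 1 := by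
    intro v h1 h2
    have := sum_yv v
    rw [h1, (natAbs_sum y 8).mp h2] at this
    push_cast at this
    omega
  rw [LY, List.mem_append, List.mem_filter, mem_genF, mem_genF, evenL_iff] at hy
  rcases hy with ⟨h1, h2⟩ | ⟨⟨h1, h2⟩, h3⟩
  · have he : ∀ i, y i = 2 * (y i / 2) := by
      intro i
      have := h1 i
      simp at this
      omega
    have hev : Even (∑ i, y i / 2) := by
      have h4 := (natAbs_sum y 8).mp h2
      have h5 : ∑ i, y i ^ 2 = 4 * ∑ i, (y i / 2) ^ 2 := by
        rw [Finset.mul_sum]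
        refine Finset.sum_congr rfl fun i _ => ?_
        conv_lhs => rw [he i]
        ring
      have h6 : (2 : ℤ) ∣ ∑ i, (y i / 2) ^ 2 - ∑ i, (y i / 2) := by
        rw [← Finset.sum_sub_distrib]
        refine Finset.dvd_sum fun i _ => ?_
        rw [show (y i / 2) ^ 2 - y i / 2 = (y i / 2 - 1) * (y i / 2 - 1 + 1) by ring]
        exact (Int.even_mul_succ_self _).two_dvd
      rw [even_iff_two_dvd]
      push_cast at h4
      omega
    refine ⟨⟨(false, fun i => y i / 2), hev⟩, ?_⟩
    have hyv : yv ⟨(false, fun i => y i / 2), hev⟩ = y := by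
      funext i
      simp only [yv]
      have := he i
      simp
      omega
    exact ⟨key _ hyv h2, hyv⟩
  · have he : ∀ i, y i = 2 * ((y i - 1) / 2) + 1 := by
      intro i
      have := h1 i
      simp at this
      omega
    have hev : Even (∑ i, (y i - 1) / 2) := by
      have h5 : ∑ i, y i = 2 * ∑ i, (y i - 1) / 2 + 8 := by
        rw [Finset.mul_sum]
        calc _ = ∑ i, (2 * ((y i - 1) / 2) + 1) := Finset.sum_congr rfl fun i _ => he i
          _ = _ := by rw [Finset.sum_add_distrib]; simp
      rw [even_iff_two_dvd]
      omega
    refine ⟨⟨(true, fun i => (y i - 1) / 2), hev⟩, ?_⟩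
    have hyv : yv ⟨(true, fun i => (y i - 1) / 2), hev⟩ = y := by
      funext i
      simp only [yv]
      have := he i
      simp
      omega
    exact ⟨key _ hyv h2, hyv⟩

end HeatAux

namespace HeatAux

lemma fib_finite (n : ℕ) : {v : V | nrm v = n}.Finite := by
  have h := (summable_poly (fun _ => 0) 0 0 (y := 1) one_pos).tendsto_cofinite_zero
  have h2 := h.eventually (gt_mem_nhds (show (0:ℝ) < Real.exp (-(Real.pi * 1 * (2 * n))) from Real.exp_pos _))
  refine (Filter.eventually_cofinite.mp h2).subset ?_
  intro v hv
  simp only [Set.mem_ofPred_eq] at hv ⊢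
  rw [sq_eq, hv]
  simp

def fib (n : ℕ) : Finset V := (fib_finite n).toFinset

lemma mem_fib (n : ℕ) (v : V) : v ∈ fib n ↔ nrm v = n := by simp [fib]

lemma zz_symm (u v : V) : zz v (co u) = zz u (co v) := by
  have h1 : ip v (co u) = ip u (co v) := by
    simp only [ip]
    exact Finset.sum_congr rfl fun i _ => mul_comm _ _
  have hu : ∑ i, co u i ^ 2 = sq u := rfl
  have hv : ∑ i, co v i ^ 2 = sq v := rfl
  simp only [zz, h1, hu, hv]
  ring

lemma Sh_fib (w : Fin 8 → ℝ) (n : ℕ) : Sh w n = ∑ v ∈ fib n, zz v w := by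
  rw [Sh]
  have : nrm ⁻¹' {n} = (fib n : Set V) := by
    ext v; simp [mem_fib]
  rw [this, Finset.tsum_subtype' (fib n) (fun v => zz v w)]

def AA : ℝ := ∑ u ∈ fib 1, ∑ v ∈ fib 1, zz v (co u)

lemma pair_sum (m n : ℕ) : ((∑ u ∈ fib m, ∑ v ∈ fib n, zz v (co u) : ℝ) : ℂ)
    = tau m * tau n * (AA : ℂ) := by
  have h1 : ((∑ u ∈ fib m, ∑ v ∈ fib n, zz v (co u) : ℝ) : ℂ) =
      tau n * ((∑ v ∈ fib 1, ∑ u ∈ fib m, zz u (co v) : ℝ) : ℂ) := by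
    rw [Finset.sum_comm (s := fib 1)]
    push_cast
    rw [Finset.mul_sum]
    refine Finset.sum_congr rfl fun u _ => ?_
    have := Sh_eq (co u) n
    rw [Sh_fib, Sh_fib] at this
    push_cast at this
    rw [this]
    simp only [zz_symm]
  have h2 : ((∑ v ∈ fib 1, ∑ u ∈ fib m, zz u (co v) : ℝ) : ℂ) = tau m * (AA : ℂ) := by
    rw [AA]
    push_cast
    rw [Finset.mul_sum]
    refine Finset.sum_congr rfl fun u _ => ?_
    have := Sh_eq (co u) m
    rw [Sh_fib, Sh_fib] at this
    push_cast at this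
    rw [this]
  rw [h1, h2]
  ring

lemma zz_hor (u v : V) (hu : nrm u = 1) (hv : nrm v = 1) :
    zz v (co u) = (hor (dot (List.ofFn (yv u)) (List.ofFn (yv v))) : ℝ) / (65536 * 604800) := by
  have hu' : ∑ i, co u i ^ 2 = 2 := by
    have : sq u = 2 := by rw [sq_eq, hu]; norm_num
    exact this
  have hv' : sq v = 2 := by rw [sq_eq, hv]; norm_num
  have hip : ip v (co u) = ((∑ i, yv u i * yv v i : ℤ) : ℝ) / 4 := by
    simp only [ip, co_eq]
    push_cast
    rw [Finset.sum_div]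
    refine Finset.sum_congr rfl fun i _ => ?_
    ring
  rw [dot_ofFn, zz, hu', hv', hip, hor]
  push_cast
  ring

lemma sum_fib_one (f : (Fin 8 → ℤ) → ℝ) : ∑ u ∈ fib 1, f (yv u) = (LY.map f).sum := by
  classical
  rw [← List.sum_toFinset f nodup_LY]
  refine Finset.sum_bij (fun u _ => yv u) ?_ ?_ ?_ ?_
  · intro u hu
    rw [List.mem_toFinset]
    exact yv_mem u ((mem_fib _ _).mp hu)
  · intro a _ b _ h
    exact yv_inj h
  · intro y hy
    obtain ⟨v, h1, h2⟩ := mem_yv y (List.mem_toFinset.mp hy)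
    exact ⟨v, (mem_fib _ _).mpr h1, h2⟩
  · intro u _
    rfl

lemma cast_dbl {α : Type} (L : List α) (f : α → α → ℤ) :
    (((L.map (fun x => (L.map (fun y => f x y)).sum)).sum : ℤ) : ℝ)
      = (L.map (fun x => (L.map (fun y => (f x y : ℝ))).sum)).sum := by
  rw [Int.cast_list_sum, List.map_map]
  congr 1
  refine List.map_congr_left fun x _ => ?_
  simp only [Function.comp_apply]
  rw [Int.cast_list_sum, List.map_map]
  rfl

lemma AA_eq : AA = 6 / 7 := by
  have hc := compute
  rw [LL_eq] at hc
  simp only [List.map_map] at hc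
  have h1 : AA = ∑ u ∈ fib 1, ∑ v ∈ fib 1,
      (hor (dot (List.ofFn (yv u)) (List.ofFn (yv v))) : ℝ) / (65536 * 604800) := by
    refine Finset.sum_congr rfl fun u hu => Finset.sum_congr rfl fun v hv => ?_
    exact zz_hor u v ((mem_fib _ _).mp hu) ((mem_fib _ _).mp hv)
  have h2 : AA = (∑ u ∈ fib 1, ∑ v ∈ fib 1,
      (hor (dot (List.ofFn (yv u)) (List.ofFn (yv v))) : ℝ)) / (65536 * 604800) := by
    rw [h1, Finset.sum_div]
    exact Finset.sum_congr rfl fun u hu => (Finset.sum_div _ _ _).symm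
  have h3 : ∑ u ∈ fib 1, ∑ v ∈ fib 1,
      (hor (dot (List.ofFn (yv u)) (List.ofFn (yv v))) : ℝ) = 33973862400 := by
    have h4 : ∀ u, ∑ v ∈ fib 1, (hor (dot (List.ofFn (yv u)) (List.ofFn (yv v))) : ℝ)
        = (LY.map (fun y => (hor (dot (List.ofFn (yv u)) (List.ofFn y)) : ℝ))).sum :=
      fun u => sum_fib_one (fun y => (hor (dot (List.ofFn (yv u)) (List.ofFn y)) : ℝ))
    simp only [h4]
    rw [sum_fib_one (fun x => (LY.map (fun y => (hor (dot (List.ofFn x) (List.ofFn y)) : ℝ))).sum)]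
    have h5 := cast_dbl LY (fun x y => hor (dot (List.ofFn x) (List.ofFn y)))
    refine h5.symm.trans ?_
    have h6 : (LY.map (fun x => (LY.map (fun y => hor (dot (List.ofFn x) (List.ofFn y)))).sum)).sum
        = 33973862400 := hc
    rw [h6]
    norm_num
  rw [h2, h3]
  norm_num

end HeatAux

namespace HeatAux

lemma hasSum_tau {q : ℂ} (hq : ‖q‖ < 1) :
    HasSum (fun m => tau m * q ^ m) (q * ∏' i : ℕ, (1 - q ^ (i + 1)) ^ 24) := by
  have h := UpperHalfPlane.hasSum_qExpansion_of_norm_lt (h := 1) (f := CuspForm.discriminant) one_pos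
    (SlashInvariantFormClass.periodic_comp_ofComplex CuspForm.discriminant
      one_mem_strictPeriods_SL)
    (ModularFormClass.holo CuspForm.discriminant)
    (ModularFormClass.bdd_at_infty CuspForm.discriminant) hq
  have h2 := ModularForm.discriminant_cuspFunction_eqOn (x := q) (by simpa using hq)
  have h3 : UpperHalfPlane.cuspFunction 1 (CuspForm.discriminant) q =
    UpperHalfPlane.cuspFunction 1 ModularForm.discriminant q := rfl
  rw [h3, h2] at h
  exact h

def DD (k : ℕ) : ℂ := ∑ p ∈ Finset.HasAntidiagonal.antidiagonal k, tau p.1 * tau p.2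

lemma hasSum_DD {q : ℂ} (hq : ‖q‖ < 1) :
    HasSum (fun k => DD k * q ^ k) (q ^ 2 * (∏' i : ℕ, (1 - q ^ (i + 1))) ^ 48) := by
  have h := hasSum_tau hq
  have hs := h.summable.norm
  have h1 := tsum_mul_tsum_eq_tsum_sum_antidiagonal_of_summable_norm hs hs
  have h2 := (summable_norm_sum_mul_antidiagonal_of_summable_norm hs hs).of_norm
  have h3 := h2.hasSum
  rw [← h1, h.tsum_eq, (ModularForm.multipliable_one_sub_pow hq).tprod_pow] at h3
  have e : q * (∏' i : ℕ, (1 - q ^ (i + 1))) ^ 24 * (q * (∏' i : ℕ, (1 - q ^ (i + 1))) ^ 24)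
    = q ^ 2 * (∏' i : ℕ, (1 - q ^ (i + 1))) ^ 48 := by ring
  rw [e] at h3
  refine h3.congr_fun fun k => ?_
  rw [DD, Finset.sum_mul]
  refine Finset.sum_congr rfl fun p hp => ?_
  rw [← Finset.HasAntidiagonal.mem_antidiagonal.mp hp, pow_add]
  ring

lemma multipliable_real {x : ℝ} (hx : |x| < 1) : Multipliable fun n : ℕ => 1 - x ^ (n + 1) := by
  apply multipliable_one_add_of_summable (f := fun n => -x ^ (n + 1))
  simpa using (summable_nat_add_iff 1).mpr (summable_geometric_of_lt_one (abs_nonneg _) hx)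

lemma c_eq (c : ℕ → ℝ) (hc : ∀ x : ℝ, |x| < 1 →
    HasSum (fun k : ℕ => c k * x ^ k) (x ^ 2 * ∏' j : ℕ, (1 - x ^ (j + 1)) ^ 48)) (k : ℕ) :
    c k = (DD k).re := by
  have hev : ∀ᶠ x : ℝ in nhds 0, |x| < 1 := by
    have := Metric.ball_mem_nhds (0 : ℝ) one_pos
    filter_upwards [this] with x hx
    simpa using hx
  have h2 : ∀ x : ℝ, |x| < 1 →
      HasSum (fun k : ℕ => (DD k).re * x ^ k) (x ^ 2 * ∏' j : ℕ, (1 - x ^ (j + 1)) ^ 48) := by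
    intro x hx
    have hq : ‖(x : ℂ)‖ < 1 := by simpa using hx
    have h := Complex.hasSum_re (hasSum_DD hq)
    have hp : ∏' i : ℕ, (1 - (x : ℂ) ^ (i + 1)) = ((∏' i : ℕ, (1 - x ^ (i + 1)) : ℝ) : ℂ) := by
      have := (multipliable_real hx).hasProd.map Complex.ofRealHom Complex.continuous_ofReal
      refine HasProd.tprod_eq ?_
      refine HasProd.congr_fun this fun i => ?_
      simp
    rw [hp] at h
    rw [(multipliable_real hx).tprod_pow 48]
    have e : ((x : ℂ) ^ 2 * ((∏' i : ℕ, (1 - x ^ (i + 1)) : ℝ) : ℂ) ^ 48).re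
        = x ^ 2 * (∏' i : ℕ, (1 - x ^ (i + 1))) ^ 48 := by
      rw [← Complex.ofReal_pow, ← Complex.ofReal_pow, ← Complex.ofReal_mul, Complex.ofReal_re]
    rw [e] at h
    refine h.congr_fun fun k => ?_
    rw [← Complex.ofReal_pow, Complex.re_mul_ofReal]
  exact congrFun (coeff_unique (hev.mono hc) (hev.mono h2)) k

end HeatAux

namespace HeatAux
open scoped Pointwise

def vec (v : V) : EuclideanSpace ℝ (Fin 8) := (Real.sqrt 2)⁻¹ • WithLp.toLp 2 (co v)

lemma vec_apply (v : V) (i : Fin 8) : vec v i = (Real.sqrt 2)⁻¹ * co v i := by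
  simp [vec]

lemma rt2 : (Real.sqrt 2)⁻¹ * (Real.sqrt 2)⁻¹ = 1 / 2 := by
  rw [← mul_inv, Real.mul_self_sqrt (by norm_num)]
  norm_num

lemma inner_vec (u v : V) : inner ℝ (vec v) (vec u) = ip v (co u) / 2 := by
  have : ∀ i, vec u i * vec v i = (co v i * co u i) / 2 := by
    intro i
    rw [vec_apply, vec_apply]
    linear_combination (co v i * co u i) * rt2
  rw [PiLp.inner_apply]
  simp only [RCLike.inner_apply, conj_trivial, this]
  rw [ip, Finset.sum_div]

lemma ip_self (v : V) : ip v (co v) = sq v := by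
  simp only [ip, sq, pow_two]

lemma norm_vec_sq (v : V) : ‖vec v‖ ^ 2 = (nrm v : ℝ) := by
  rw [← real_inner_self_eq_norm_sq, inner_vec, ip_self, sq_eq]
  ring

lemma vec_inj : Function.Injective vec := by
  intro u v h
  apply yv_inj
  funext i
  have h1 : vec u i = vec v i := by rw [h]
  rw [vec_apply, vec_apply, co_eq, co_eq] at h1
  have h2 : (Real.sqrt 2)⁻¹ ≠ 0 := by positivity
  have h3 := mul_left_cancel₀ h2 h1
  have h4 : (yv u i : ℝ) = yv v i := by linarith
  exact_mod_cast h4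

lemma vec_mem (v : V) : vec v ∈ (Real.sqrt 2)⁻¹ • Heat.E8set := by
  refine Set.smul_mem_smul_set ?_
  obtain ⟨⟨b, z⟩, hz⟩ := v
  obtain ⟨r, hr⟩ : Even (∑ i, z i) := hz
  have hr' : ∑ i, (z i : ℝ) = r + r := by exact_mod_cast congrArg (Int.cast : ℤ → ℝ) hr
  cases b
  · refine ⟨Or.inl fun i => ⟨z i, by simp [co, co']⟩, r, ?_⟩
    simp only [co, co']
    simp [hr']
    ring
  · refine ⟨Or.inr fun i => ⟨z i, by simp [co, co']⟩, r + 2, ?_⟩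
    simp only [co, co']
    simp [hr', Finset.sum_add_distrib]
    ring

lemma mem_vec (x : EuclideanSpace ℝ (Fin 8)) (hx : x ∈ (Real.sqrt 2)⁻¹ • Heat.E8set) :
    ∃ v, vec v = x := by
  obtain ⟨y, ⟨hy, s, hs⟩, rfl⟩ := Set.mem_smul_set.mp hx
  rcases hy with hy | hy
  · choose z hz using hy
    have he : Even (∑ i, z i) := by
      simp only [hz] at hs
      have : ∑ i, z i = 2 * s := by exact_mod_cast hs
      exact ⟨s, by omega⟩
    refine ⟨⟨(false, z), he⟩, ?_⟩
    ext i
    refine (vec_apply _ i).trans ?_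
    simp [co, co', hz]
  · choose z hz using hy
    have he : Even (∑ i, z i) := by
      simp only [hz, Finset.sum_add_distrib] at hs
      have h2 : (∑ i, (z i : ℝ)) + 4 = 2 * s := by
        rw [← hs]
        simp
        norm_num
      have : ∑ i, z i + 4 = 2 * s := by exact_mod_cast h2
      exact ⟨s - 2, by omega⟩
    refine ⟨⟨(true, z), he⟩, ?_⟩
    ext i
    refine (vec_apply _ i).trans ?_
    simp [co, co', hz]

lemma pm_eval (c : ℝ) : Heat.pmVal 8 4 c = 1 / 40320 * c ^ 8 - 1 / 28800 * c ^ 6 +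
    1 / 69120 * c ^ 4 - 1 / 552960 * c ^ 2 + 1 / 30965760 := by
  simp only [Heat.pmVal, Finset.sum_range_succ, Finset.prod_range_succ, Finset.sum_range_zero,
    Finset.prod_range_zero, Nat.factorial]
  norm_num
  ring

lemma vec_ne_zero (v : V) : vec v ≠ 0 ↔ nrm v ≠ 0 := by
  have := norm_vec_sq v
  rw [not_iff_not, ← norm_eq_zero, ← sq_eq_zero_iff, this]
  exact Nat.cast_eq_zero

lemma pm_zz (u v : V) (hu : nrm u ≠ 0) (hv : nrm v ≠ 0) :
    Heat.pmVal 8 4 (inner ℝ (vec u) (vec v) / (‖vec u‖ * ‖vec v‖)) * ‖vec u‖ ^ 8 * ‖vec v‖ ^ 8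
      = zz u (co v) / 256 := by
  have ha : ‖vec u‖ ≠ 0 := norm_ne_zero_iff.mpr ((vec_ne_zero u).mpr hu)
  have hb : ‖vec v‖ ≠ 0 := norm_ne_zero_iff.mpr ((vec_ne_zero v).mpr hv)
  have ha2 : sq u = 2 * ‖vec u‖ ^ 2 := by rw [norm_vec_sq, sq_eq]
  have hb2 : ∑ i, co v i ^ 2 = 2 * ‖vec v‖ ^ 2 := by rw [norm_vec_sq, ← sq_eq]; rfl
  rw [pm_eval, inner_vec, zz, ha2, hb2]
  generalize ‖vec u‖ = a at *
  generalize ‖vec v‖ = b at *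
  generalize ip u (co v) = t
  field_simp
  ring

def SS (k : ℕ) : Finset (V × V) := by
  classical
  exact (Finset.HasAntidiagonal.antidiagonal k).biUnion (fun p => fib p.1 ×ˢ fib p.2)

lemma mem_SS (k : ℕ) (q : V × V) : q ∈ SS k ↔ nrm q.1 + nrm q.2 = k := by
  classical
  rw [SS, Finset.mem_biUnion]
  constructor
  · rintro ⟨p, hp, hq⟩
    rw [Finset.mem_product, mem_fib, mem_fib] at hq
    rw [hq.1, hq.2]
    exact Finset.HasAntidiagonal.mem_antidiagonal.mp hp
  · intro h
    refine ⟨(nrm q.1, nrm q.2), Finset.HasAntidiagonal.mem_antidiagonal.mpr h, ?_⟩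
    rw [Finset.mem_product, mem_fib, mem_fib]
    exact ⟨rfl, rfl⟩

lemma sum_SS (k : ℕ) (f : V × V → ℝ) : ∑ q ∈ SS k, f q =
    ∑ p ∈ Finset.HasAntidiagonal.antidiagonal k, ∑ u ∈ fib p.1, ∑ v ∈ fib p.2, f (u, v) := by
  classical
  rw [SS, Finset.sum_biUnion]
  · exact Finset.sum_congr rfl fun p _ => Finset.sum_product _ _ _
  · intro p _ p' _ hpp
    rw [Function.onFun, Finset.disjoint_left]
    intro q hq hq'
    rw [Finset.mem_product, mem_fib, mem_fib] at hq hq'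
    exact hpp (Prod.ext (hq.1.symm.trans hq'.1) (hq.2.symm.trans hq'.2))

lemma total (k : ℕ) : ∑ q ∈ SS k, zz q.1 (co q.2) = (DD k).re * (6 / 7) := by
  rw [sum_SS]
  have h : ((∑ p ∈ Finset.HasAntidiagonal.antidiagonal k, ∑ u ∈ fib p.1, ∑ v ∈ fib p.2,
      zz u (co v) : ℝ) : ℂ) = DD k * ((6 / 7 : ℝ) : ℂ) := by
    rw [Complex.ofReal_sum, DD, Finset.sum_mul]
    refine Finset.sum_congr rfl fun p _ => ?_
    have := pair_sum p.1 p.2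
    simp only [AA_eq] at this
    rw [← this]
    congr 1
    exact Finset.sum_congr rfl fun u _ => Finset.sum_congr rfl fun v _ => zz_symm v u
  have h2 := congrArg Complex.re h
  rwa [Complex.ofReal_re, Complex.re_mul_ofReal] at h2

end HeatAux

namespace Heat

open scoped Pointwise

/-- for the rescaled lattice `Λ = (1/√2)E₈`, the coefficients of
`Θ_{4,4,Λ}` equal `3/896` times the coefficients of `Δ(q)² = q²∏(1-q^j)^{48}`. -/
theorem statement18 (c : ℕ → ℝ)
    (hc : ∀ x : ℝ, |x| < 1 →
      HasSum (fun k => c k * x ^ k) (x ^ 2 * ∏' j : ℕ, (1 - x ^ (j + 1)) ^ 48))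
    (k : ℕ) :
    ∑' p : {p : E 8 × E 8 //
        p.1 ∈ (Real.sqrt 2)⁻¹ • E8set ∧ p.2 ∈ (Real.sqrt 2)⁻¹ • E8set ∧
        p.1 ≠ 0 ∧ p.2 ≠ 0 ∧ ‖p.1‖ ^ 2 + ‖p.2‖ ^ 2 = (k : ℝ)},
      pmVal 8 4 (⟪p.1.1, p.1.2⟫ / (‖p.1.1‖ * ‖p.1.2‖)) * ‖p.1.1‖ ^ 8 * ‖p.1.2‖ ^ 8 =
    (3 / 896) * c k := by
  classical
  let S : Finset (HeatAux.V × HeatAux.V) :=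
    (HeatAux.SS k).filter (fun q => HeatAux.nrm q.1 ≠ 0 ∧ HeatAux.nrm q.2 ≠ 0)
  have hS : ∀ q, q ∈ S ↔ HeatAux.nrm q.1 + HeatAux.nrm q.2 = k ∧
      HeatAux.nrm q.1 ≠ 0 ∧ HeatAux.nrm q.2 ≠ 0 := by
    intro q
    rw [Finset.mem_filter, HeatAux.mem_SS]
  let φ : S → {p : E 8 × E 8 //
        p.1 ∈ (Real.sqrt 2)⁻¹ • E8set ∧ p.2 ∈ (Real.sqrt 2)⁻¹ • E8set ∧
        p.1 ≠ 0 ∧ p.2 ≠ 0 ∧ ‖p.1‖ ^ 2 + ‖p.2‖ ^ 2 = (k : ℝ)} := fun q =>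
    ⟨(HeatAux.vec q.1.1, HeatAux.vec q.1.2), HeatAux.vec_mem _, HeatAux.vec_mem _,
      (HeatAux.vec_ne_zero _).mpr ((hS q.1).mp q.2).2.1,
      (HeatAux.vec_ne_zero _).mpr ((hS q.1).mp q.2).2.2, by
        have h := ((hS q.1).mp q.2).1
        rw [HeatAux.norm_vec_sq, HeatAux.norm_vec_sq]
        exact_mod_cast h⟩
  have hφ : Function.Bijective φ := by
    constructor
    · rintro ⟨⟨a, b⟩, hq⟩ ⟨⟨a', b'⟩, hq'⟩ h
      have h1 := congrArg Subtype.val h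
      have h2 : HeatAux.vec a = HeatAux.vec a' := congrArg Prod.fst h1
      have h3 : HeatAux.vec b = HeatAux.vec b' := congrArg Prod.snd h1
      have h4 := HeatAux.vec_inj h2
      have h5 := HeatAux.vec_inj h3
      subst h4
      subst h5
      rfl
    · rintro ⟨⟨x, y⟩, hx, hy, hx0, hy0, hk⟩
      obtain ⟨a, rfl⟩ := HeatAux.mem_vec x hx
      obtain ⟨b, rfl⟩ := HeatAux.mem_vec y hy
      refine ⟨⟨(a, b), (hS _).mpr ⟨?_, (HeatAux.vec_ne_zero _).mp hx0,
        (HeatAux.vec_ne_zero _).mp hy0⟩⟩, rfl⟩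
      simp only at hk
      rw [HeatAux.norm_vec_sq, HeatAux.norm_vec_sq] at hk
      exact_mod_cast hk
  rw [← (Equiv.ofBijective φ hφ).tsum_eq]
  have h1 : ∀ q : S, pmVal 8 4 (⟪(φ q).1.1, (φ q).1.2⟫ / (‖(φ q).1.1‖ * ‖(φ q).1.2‖))
      * ‖(φ q).1.1‖ ^ 8 * ‖(φ q).1.2‖ ^ 8 = HeatAux.zz q.1.1 (HeatAux.co q.1.2) / 256 :=
    fun q => HeatAux.pm_zz q.1.1 q.1.2 ((hS q.1).mp q.2).2.1 ((hS q.1).mp q.2).2.2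
  refine (tsum_congr h1).trans ?_
  rw [Finset.tsum_subtype S (fun q => HeatAux.zz q.1 (HeatAux.co q.2) / 256), ← Finset.sum_div,
    Finset.sum_filter_of_ne, HeatAux.total, HeatAux.c_eq c hc k]
  · ring
  · intro q _ hq
    constructor
    · intro h
      exact hq (HeatAux.zz_eq_zero _ _ h)
    · intro h
      apply hq
      rw [HeatAux.zz_symm]
      exact HeatAux.zz_eq_zero _ _ h

end Heat
end
end
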